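/- Let s > 1. A complex number ξ is a root of the polynomial J_s(X,X) if and only if ξ = j(ρ) for some ρ ∈ ℍ that is a fixed point of the Möbius action of some primitive integer matrix of determinant s; every such ρ is imaginary quadratic ([ℚ(ρ):ℚ] = 2). Moreover, the multiplicity of ξ = j(ρ) as a root of J_s(X,X) equals the number of SL₂(ℤ)-inequivalent (with respect to left multiplication) primitive integer matrices S of determinant s satisfying S·ρ = ρ. -/

import Mathlib

open Polynomial Complex IntermediateField

noncomputable section

/-- 2×2 integer matrices. -/
abbrev Mat : Type := Matrix (Fin 2) (Fin 2) ℤ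

/-- The modular group SL₂(ℤ). -/
abbrev SL2Z := Matrix.SpecialLinearGroup (Fin 2) ℤ

/-- A 2×2 integer matrix is primitive if the gcd of its four entries is 1. -/
def Mat.IsPrimitive (S : Mat) : Prop :=
  Nat.gcd (Nat.gcd (S 0 0).natAbs (S 0 1).natAbs)
    (Nat.gcd (S 1 0).natAbs (S 1 1).natAbs) = 1

/-- Left equivalence of matrices under SL₂(ℤ). -/
def LeftEquiv (S T : Mat) : Prop := ∃ M : SL2Z, S = (M : Mat) * T

/-- Möbius action of an integer matrix on a complex number. -/
def moeb (S : Mat) (z : ℂ) : ℂ :=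
  ((S 0 0 : ℂ) * z + (S 0 1 : ℂ)) / ((S 1 0 : ℂ) * z + (S 1 1 : ℂ))

/-- ψ(s) = s·∏_{p∣s}(1+1/p) = Σ_{d∣s squarefree} s/d. -/
def psi (s : ℕ) : ℕ := ∑ d ∈ s.divisors, if Squarefree d then s / d else 0

/-- Eisenstein series g₂. -/
def g2C (z : ℂ) : ℂ :=
  60 * ∑' w : {v : ℤ × ℤ // v ≠ 0}, ((w.1.1 : ℂ) * z + (w.1.2 : ℂ)) ^ (-4 : ℤ)

/-- Eisenstein series g₃. -/
def g3C (z : ℂ) : ℂ :=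
  140 * ∑' w : {v : ℤ × ℤ // v ≠ 0}, ((w.1.1 : ℂ) * z + (w.1.2 : ℂ)) ^ (-6 : ℤ)

/-- The discriminant Δ. -/
def discC (z : ℂ) : ℂ := g2C z ^ 3 - 27 * g3C z ^ 2

/-- The modular invariant j. -/
def jC (z : ℂ) : ℂ := 1728 * g2C z ^ 3 / discC z

/-- A family of matrices is a complete system of representatives of the left SL₂(ℤ)-orbits
of primitive integer matrices of determinant `s`. -/
def IsOrbitReps (s : ℕ) {n : ℕ} (R : Fin n → Mat) : Prop :=
  (∀ ν, (R ν).IsPrimitive ∧ (R ν).det = (s : ℤ)) ∧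
  ∀ T : Mat, T.IsPrimitive → T.det = (s : ℤ) → ∃! ν, LeftEquiv T (R ν)

/-- Evaluation of an integer polynomial at j(z). -/
def evalAtJ (z : ℂ) : Polynomial ℤ →+* ℂ := eval₂RingHom (Int.castRingHom ℂ) (jC z)

/-- J is the modular polynomial of level s: an element of ℤ[Y][X], monic in X of degree ψ(s),
such that J(X, j(ω)) = ∏_ν (X − j(S_ν ω)) for every ω in the upper half-plane. -/
def IsModularPoly (s : ℕ) (J : Polynomial (Polynomial ℤ)) : Prop :=
  J.Monic ∧ J.natDegree = psi s ∧
  ∀ R : Fin (psi s) → Mat, IsOrbitReps s R → ∀ z : ℂ, 0 < z.im →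
    J.map (evalAtJ z) = ∏ ν, (X - C (jC (moeb (R ν) z)))

/-- The one-variable polynomial J(X,X) obtained by setting Y = X. -/
def diagPoly (J : Polynomial (Polynomial ℤ)) : Polynomial ℤ := J.eval Polynomial.X

/-- φ_S(ω) = s¹²·Δ(Sω)/((cω+d)¹²·Δ(ω)). -/
def phiS (S : Mat) (z : ℂ) : ℂ :=
  (S.det : ℂ) ^ 12 * discC (moeb S z) /
    (((S 1 0 : ℂ) * z + (S 1 1 : ℂ)) ^ 12 * discC z)

/-- K is an imaginary quadratic subfield of ℂ. -/
def IsImagQuad (K : Subfield ℂ) : Prop :=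
  ∃ θ : ℂ, 0 < θ.im ∧ Module.finrank ℚ ℚ⟮θ⟯ = 2 ∧ K = ℚ⟮θ⟯.toSubfield

/-- O is an order of the field K: a subring of K which is a finitely generated additive
group containing a ℚ-basis of K. -/
structure IsOrder (K : Subfield ℂ) (O : Subring ℂ) : Prop where
  le : (O : Set ℂ) ⊆ (K : Set ℂ)
  fg : O.toAddSubgroup.FG
  full : ∀ x ∈ K, ∃ n : ℤ, n ≠ 0 ∧ (n : ℂ) * x ∈ O

/-- The lattice spanned by a and b. -/
def zLat (a b : ℂ) : AddSubgroup ℂ := AddSubgroup.closure {a, b}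

/-- (a,b) is a ℤ-basis (with Im(a/b) > 0) of a proper (characteristic) ideal of the
order O of K: the lattice ℤa+ℤb lies in K and its multiplier ring is exactly O. -/
def IsIdealBasis (K : Subfield ℂ) (O : Subring ℂ) (a b : ℂ) : Prop :=
  0 < (a / b).im ∧ a ∈ K ∧ b ∈ K ∧
  ∀ lam : ℂ, lam ∈ O ↔ (lam * a ∈ zLat a b ∧ lam * b ∈ zLat a b)

/-- Two lattices differ by a nonzero scalar factor. -/
def LatEquiv (A B : AddSubgroup ℂ) : Prop :=
  ∃ μ : ℂ, μ ≠ 0 ∧ (B : Set ℂ) = (fun z => μ * z) '' (A : Set ℂ)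

/-- The two ideals with the given bases lie in the same ideal class. -/
def IdealEquiv (a b a' b' : ℂ) : Prop := LatEquiv (zLat a b) (zLat a' b')

/-- Product of two lattices. -/
def latMul (A B : AddSubgroup ℂ) : AddSubgroup ℂ :=
  AddSubgroup.closure {z : ℂ | ∃ x ∈ A, ∃ y ∈ B, z = x * y}

/-- μ is a primitive element of the order O : μ ∈ O and μ/t ∉ O for every integer t > 1. -/
def IsPrimElem (O : Subring ℂ) (μ : ℂ) : Prop :=
  μ ∈ O ∧ ∀ t : ℤ, 1 < t → μ / (t : ℂ) ∉ O

/-- μ and μ' are associated in O (differ by a unit of O). -/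
def UnitAssoc (O : Subring ℂ) (μ μ' : ℂ) : Prop :=
  ∃ ε : ℂ, ε ∈ O ∧ ε ≠ 0 ∧ ε⁻¹ ∈ O ∧ μ' = ε * μ

/-- The ring of integers of a subfield K of ℂ, as a subring of ℂ. -/
def OK (K : Subfield ℂ) : Subring ℂ := (integralClosure ℤ ℂ).toSubring ⊓ K.toSubring

/-- The index of an order O in the maximal order of K (for a quadratic field this
equals the conductor f of O). -/
def condIndex (K : Subfield ℂ) (O : Subring ℂ) : ℕ :=
  (O.toAddSubgroup.addSubgroupOf (OK K).toAddSubgroup).index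

/-- The lattice in ℂ attached to an ideal of the maximal order of K. -/
def idealLat (K : Subfield ℂ) (I : Ideal ↥(OK K)) : AddSubgroup ℂ :=
  AddSubgroup.closure {z : ℂ | ∃ x ∈ I, (x : ℂ) = z}

/-- The lattice attached to the O-ideal I ∩ O, for an ideal I of the maximal order. -/
def primeOrderLat (K : Subfield ℂ) (O : Subring ℂ) (I : Ideal ↥(OK K)) : AddSubgroup ℂ :=
  AddSubgroup.closure {z : ℂ | z ∈ O ∧ ∃ x ∈ I, (x : ℂ) = z}

/-- The set of all class invariants j(k) of ideal classes of the order O. -/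
def classInvSet (K : Subfield ℂ) (O : Subring ℂ) : Set ℂ :=
  {w : ℂ | ∃ a b : ℂ, IsIdealBasis K O a b ∧ w = jC (a / b)}

/-- The ring class field Ω_R : the subfield of ℂ generated by K together with all
class invariants of the order O. -/
def ringClassField (K : Subfield ℂ) (O : Subring ℂ) : Subfield ℂ :=
  Subfield.closure ((K : Set ℂ) ∪ classInvSet K O)

theorem le_ringClassField (K : Subfield ℂ) (O : Subring ℂ) : K ≤ ringClassField K O :=
  fun _ hx => Subfield.subset_closure (Set.mem_union_left _ hx)

noncomputable instance rcfAlgebra (K : Subfield ℂ) (O : Subring ℂ) :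
    Algebra ↥K ↥(ringClassField K O) :=
  (Subfield.inclusion (le_ringClassField K O)).toAlgebra

theorem OK_mono {K L : Subfield ℂ} (h : K ≤ L) : OK K ≤ OK L := by
  intro x hx
  rw [OK, Subring.mem_inf] at hx ⊢
  exact ⟨hx.1, h hx.2⟩

/-- 𝔭 splits completely in L/K: the extension of 𝔭 to the ring of integers of L is a
product of pairwise distinct primes, each of residue degree one over 𝔭. -/
def SplitsCompletely (K L : Subfield ℂ) (h : K ≤ L) (p : Ideal ↥(OK K)) : Prop :=
  ∃ (g : ℕ) (Q : Fin g → Ideal ↥(OK L)),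
    Function.Injective Q ∧ (∀ i, (Q i).IsPrime) ∧
    Ideal.map (Subring.inclusion (OK_mono h)) p = ∏ i, Q i ∧
    ∀ i, Nat.card (↥(OK L) ⧸ Q i) = Nat.card (↥(OK K) ⧸ p)

/-- L is a finite extension of ℚ (a number field) inside ℂ. -/
def FinDimOverQ (L : Subfield ℂ) : Prop :=
  ∃ t : Finset ℂ, (L : Set ℂ) ⊆ (Submodule.span ℚ (t : Set ℂ) : Submodule ℚ ℂ)

/-- Lattice Eisenstein sums Σ_{w∈L, w≠0} w^{-k}. -/
def gkL (k : ℕ) (L : AddSubgroup ℂ) : ℂ :=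
  ∑' w : {w : ℂ // w ∈ L ∧ w ≠ 0}, (w : ℂ) ^ (-(k : ℤ))

def g2L (L : AddSubgroup ℂ) : ℂ := 60 * gkL 4 L
def g3L (L : AddSubgroup ℂ) : ℂ := 140 * gkL 6 L
def discL (L : AddSubgroup ℂ) : ℂ := g2L L ^ 3 - 27 * g3L L ^ 2

/-- The Weierstrass ℘-function of a lattice. -/
def wpL (z : ℂ) (L : AddSubgroup ℂ) : ℂ :=
  z ^ (-2 : ℤ) + ∑' w : {w : ℂ // w ∈ L ∧ w ≠ 0},
    ((z - (w : ℂ)) ^ (-2 : ℤ) - (w : ℂ) ^ (-2 : ℤ))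

/-- The Weber function τ_R(z, 𝔴), where e is the number of units of R. -/
def weber (e : ℕ) (z : ℂ) (L : AddSubgroup ℂ) : ℂ :=
  if e = 4 then 2 ^ 8 * 3 ^ 4 * (g2L L ^ 2 / discL L) * wpL z L ^ 2
  else if e = 6 then -(2 ^ 9 * 3 ^ 6) * (g3L L / discL L) * wpL z L ^ 3
  else -(2 ^ 7 * 3 ^ 5) * (g2L L * g3L L / discL L) * wpL z L

/-- The number of units (roots of unity) in the ring of integers of K. -/
def numRootsOfUnity (K : Subfield ℂ) : ℕ :=
  Nat.card {x : ℂ // x ∈ OK K ∧ ∃ n : ℕ, 0 < n ∧ x ^ n = 1}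

/-- λ ≡ 1 mod* 𝔪 (multiplicative congruence): λ = β/γ with β, γ integral and prime
to 𝔪 and β ≡ γ mod 𝔪. -/
def MulCongOne (K : Subfield ℂ) (m : Ideal ↥(OK K)) (lam : ℂ) : Prop :=
  ∃ β γ : ↥(OK K), (γ : ℂ) ≠ 0 ∧ lam = (β : ℂ) / (γ : ℂ) ∧
    Ideal.span {β} ⊔ m = ⊤ ∧ Ideal.span {γ} ⊔ m = ⊤ ∧ β - γ ∈ m

/-- The Dedekind eta function. -/
def dedekindEta (z : ℂ) : ℂ :=
  Complex.exp (Real.pi * Complex.I * z / 12) *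
    ∏' n : ℕ, (1 - Complex.exp (2 * Real.pi * Complex.I * ((n : ℂ) + 1) * z))

/-- ζ₂₄ = e^{2πi/24}. -/
def zeta24 : ℂ := Complex.exp (2 * Real.pi * Complex.I / 24)

/-- The image of the basis (a,b) under an integer matrix. -/
def matBasis (P : Mat) (a b : ℂ) : ℂ × ℂ :=
  ((P 0 0 : ℂ) * a + (P 0 1 : ℂ) * b, (P 1 0 : ℂ) * a + (P 1 1 : ℂ) * b)

/-- The image of the basis (a,b) under a rational matrix. -/
def matBasisQ (B : Matrix (Fin 2) (Fin 2) ℚ) (a b : ℂ) : ℂ × ℂ :=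
  ((B 0 0 : ℂ) * a + (B 0 1 : ℂ) * b, (B 1 0 : ℂ) * a + (B 1 1 : ℂ) * b)

/-- φ_B for a rational matrix B of positive determinant. -/
def phiQ (B : Matrix (Fin 2) (Fin 2) ℚ) (z : ℂ) : ℂ :=
  (B.det : ℂ) ^ 12 *
      discC (((B 0 0 : ℂ) * z + (B 0 1 : ℂ)) / ((B 1 0 : ℂ) * z + (B 1 1 : ℂ))) /
    (((B 1 0 : ℂ) * z + (B 1 1 : ℂ)) ^ 12 * discC z)

/-- The lattice attached to the complex conjugate of an ideal of the maximal order. -/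
def conjIdealLat (K : Subfield ℂ) (I : Ideal ↥(OK K)) : AddSubgroup ℂ :=
  AddSubgroup.closure {z : ℂ | ∃ x ∈ I, (starRingEnd ℂ) (x : ℂ) = z}

/-- The triangular representatives (a b; 0 d), a·d = s, gcd(a,b,d) = 1, 0 ≤ b < d,
encoded as triples (a, b, d). -/
def triReps (s : ℕ) : Finset (ℕ × ℕ × ℕ) :=
  (Finset.range (s + 1) ×ˢ Finset.range (s + 1) ×ˢ Finset.range (s + 1)).filter
    (fun t => 0 < t.1 ∧ 0 < t.2.2 ∧ t.1 * t.2.2 = s ∧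
      Nat.gcd t.1 (Nat.gcd t.2.1 t.2.2) = 1 ∧ t.2.1 < t.2.2)

section

open UpperHalfPlane ModularForm EisensteinSeries MatrixGroups Filter Topology

theorem tsum_ne_zero_zpow_eq_eisenstein {k : ℕ} (hk : 3 ≤ k) (z : ℍ) :
    ∑' w : {v : ℤ × ℤ // v ≠ 0}, ((w.1.1 : ℂ) * z + (w.1.2 : ℂ)) ^ (-k : ℤ) =
      2 * riemannZeta k * E hk z := by
  have hE : E hk z = (1 / 2 : ℂ) * eisensteinSeries (N := 1) 0 k z := rfl
  rw [hE]
  have h := tsum_eisSummand_eq_riemannZeta_mul_eisensteinSeries hk z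
  rw [← (finTwoArrowEquiv ℤ).symm.tsum_eq] at h
  rw [show 2 * riemannZeta k * (1 / 2 * eisensteinSeries (N := 1) 0 k z) =
    riemannZeta k * eisensteinSeries (N := 1) 0 k z by ring, ← h]
  refine (tsum_subtype_eq_of_support_subset (s := {v : ℤ × ℤ | v ≠ 0})
    (f := fun v : ℤ × ℤ => ((v.1 : ℂ) * z + (v.2 : ℂ)) ^ (-k : ℤ)) ?_).trans ?_
  · rintro v hv rfl
    apply hv
    have : (-k : ℤ) ≠ 0 := by omega
    simp [zero_zpow _ this]
  · refine tsum_congr fun v => ?_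
    simp [eisSummand]

theorem g2C_eq (z : ℍ) : g2C z = 4 * Real.pi ^ 4 / 3 * E₄ z := by
  have h := tsum_ne_zero_zpow_eq_eisenstein (k := 4) (by norm_num) z
  simp only [Nat.cast_ofNat] at h
  rw [g2C, h, riemannZeta_four]
  ring

theorem riemannZeta_six : riemannZeta 6 = Real.pi ^ 6 / 945 := by
  have h := riemannZeta_two_mul_nat (k := 3) (by norm_num)
  norm_num [show _root_.bernoulli 6 = 1 / 42 by decide +kernel, Nat.factorial] at h
  rw [h]; ring

theorem g3C_eq (z : ℍ) : g3C z = 8 * Real.pi ^ 6 / 27 * E₆ z := by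
  have h := tsum_ne_zero_zpow_eq_eisenstein (k := 6) (by norm_num) z
  simp only [Nat.cast_ofNat] at h
  rw [g3C, h, riemannZeta_six]
  ring

theorem discC_eq (z : ℍ) : discC z = 4096 * Real.pi ^ 12 * discriminant z := by
  rw [discC, g2C_eq, g3C_eq, discriminant_eq_E₄_cube_sub_E₆_sq]
  ring

theorem discC_ne_zero (z : ℍ) : discC z ≠ 0 := by
  rw [discC_eq]
  have : (Real.pi : ℂ) ≠ 0 := by exact_mod_cast Real.pi_ne_zero
  exact mul_ne_zero (mul_ne_zero (by norm_num) (pow_ne_zero _ this)) (discriminant_ne_zero z)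

theorem jC_eq (z : ℍ) : jC z = E₄ z ^ 3 / discriminant z := by
  have := discriminant_ne_zero z
  have : (Real.pi : ℂ) ≠ 0 := by exact_mod_cast Real.pi_ne_zero
  rw [jC, discC_eq, g2C_eq]
  field_simp
  ring

theorem apply_smul_of_slash_eq {f : ℍ → ℂ} {k : ℤ} {γ : SL(2, ℤ)} (h : f ∣[k] γ = f) (z : ℍ) :
    f (γ • z) = f z * denom γ z ^ k := by
  have h1 := congrFun h z
  rw [SL_slash_apply] at h1
  rw [← h1, mul_assoc, ← zpow_add₀ (denom_ne_zero γ z)]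
  simp

theorem jC_smul (γ : SL(2, ℤ)) (z : ℍ) : jC (γ • z : ℍ) = jC z := by
  rw [jC_eq, jC_eq]
  have h1 := apply_smul_of_slash_eq (k := 4) (γ := γ) (f := E₄) (E₄.slash_action_eq' _ ⟨γ, rfl⟩) z
  have h2 := apply_smul_of_slash_eq (k := 12) (γ := γ) (f := discriminant)
    (CuspForm.discriminant.slash_action_eq' _ ⟨γ, rfl⟩) z
  have hd := denom_ne_zero γ z
  rw [h1, h2, show (12 : ℤ) = 4 * (3 : ℕ) by norm_num, zpow_mul, zpow_natCast, mul_pow,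
    mul_div_mul_right _ _ (pow_ne_zero _ (zpow_ne_zero _ hd))]

theorem differentiableOn_jC : DifferentiableOn ℂ jC {z | 0 < z.im} := by
  have h1 := (UpperHalfPlane.mdifferentiable_iff.mp E₄.holo')
  have h2 := (UpperHalfPlane.mdifferentiable_iff.mp CuspForm.discriminant.holo')
  refine ((h1.pow 3).div h2 fun z hz => discriminant_ne_zero _).congr fun z hz => ?_
  have := jC_eq ⟨z, hz⟩
  simp only [Function.comp_def, Pi.pow_apply, Pi.div_apply, ofComplex_apply_of_im_pos hz]
  exact this

theorem tendsto_E₄_atImInfty : Tendsto (fun z : ℍ => E₄ z) atImInfty (𝓝 1) := by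
  have hv : cuspFunction 1 E₄ 0 = 1 := by
    rw [← E_qExpansion_coeff_zero (k := 4) (by norm_num) ⟨2, rfl⟩, qExpansion_coeff]
    simp
  have ha := ModularFormClass.analyticAt_cuspFunction_zero E₄ one_pos one_mem_strictPeriods_SL
  have h := ha.continuousAt.tendsto.comp (qParam_tendsto_atImInfty one_pos)
  rw [hv] at h
  refine h.congr fun z => ?_
  exact SlashInvariantFormClass.eq_cuspFunction E₄ z one_mem_strictPeriods_SL one_ne_zero

/-- If `E₄ ^ 3 - ξ Δ` had no zero, then `Δ / (E₄ ^ 3 - ξ Δ)` would be a modular form of weight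
zero. -/
theorem exists_jC_eq (ξ : ℂ) : ∃ z : ℍ, jC z = ξ := by
  by_contra! hne
  set f : ℍ → ℂ := fun z => E₄ z ^ 3 - ξ * discriminant z with hf
  have hf0 : ∀ z, f z ≠ 0 := fun z h => hne z <| by
    rw [jC_eq, div_eq_iff (discriminant_ne_zero z)]
    exact sub_eq_zero.mp h
  have hlim : Tendsto (fun z => discriminant z / f z) atImInfty (𝓝 0) := by
    have hΔ : Tendsto discriminant atImInfty (𝓝 0) := discriminant_isZeroAtImInfty
    have := hΔ.div ((tendsto_E₄_atImInfty.pow 3).sub (hΔ.const_mul ξ)) (by simp)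
    rwa [zero_div] at this
  have hinv : ∀ γ : SL(2, ℤ), (fun z => discriminant z / f z) ∣[(0 : ℤ)] γ =
      fun z => discriminant z / f z := by
    intro γ
    ext z
    have h1 := apply_smul_of_slash_eq (k := 4) (γ := γ) (f := E₄)
      (E₄.slash_action_eq' _ ⟨γ, rfl⟩) z
    have h2 := apply_smul_of_slash_eq (k := 12) (γ := γ) (f := discriminant)
      (CuspForm.discriminant.slash_action_eq' _ ⟨γ, rfl⟩) z
    have hd := denom_ne_zero γ z
    rw [SL_slash_apply]
    simp only [hf, neg_zero, zpow_zero, mul_one]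
    rw [h1, h2, show (12 : ℤ) = 4 * (3 : ℕ) by norm_num, zpow_mul, zpow_natCast, mul_pow,
      ← mul_assoc, ← sub_mul, mul_div_mul_right _ _ (pow_ne_zero _ (zpow_ne_zero _ hd))]
  let g : ModularForm 𝒮ℒ 0 :=
    { toFun := fun z => discriminant z / f z
      slash_action_eq' := fun _ ⟨γ, hγ⟩ => hγ ▸ hinv γ
      holo' := by
        rw [UpperHalfPlane.mdifferentiable_iff]
        have h1 := (UpperHalfPlane.mdifferentiable_iff.mp E₄.holo')
        have h2 := (UpperHalfPlane.mdifferentiable_iff.mp CuspForm.discriminant.holo')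
        exact h2.div ((h1.pow 3).sub (h2.const_mul ξ)) fun z hz => hf0 _
      bdd_at_cusps' := fun {c} hc => by
        rw [Subgroup.IsArithmetic.isCusp_iff_isCusp_SL2Z] at hc
        rw [OnePoint.isBoundedAt_iff_forall_SL2Z hc]
        intro γ _
        rw [hinv γ]
        exact hlim.isBigO_one ℝ }
  obtain ⟨c, hc⟩ := ModularFormClass.levelOne_weight_zero_const g
  have hc' : ∀ z, discriminant z / f z = c := fun z => congrFun hc z
  have : c = 0 := by
    refine tendsto_nhds_unique ?_ hlim
    simp only [hc']
    exact tendsto_const_nhds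
  have h := hc' I
  rw [this] at h
  exact div_ne_zero (discriminant_ne_zero I) (hf0 I) h

/-- An indicial-equation argument: an analytic solution of `z u' A = u B` vanishing at the origin
is zero when no positive integer satisfies the indicial equation. -/
theorem eventually_eq_zero_of_mul_deriv {u A B : ℂ → ℂ} (hu : AnalyticAt ℂ u 0) (hu0 : u 0 = 0)
    (hA : ContinuousAt A 0) (hB : ContinuousAt B 0) (hAB : ∀ n : ℕ, n ≠ 0 → n * A 0 ≠ B 0)
    (h : ∀ᶠ z in 𝓝[≠] (0 : ℂ), z * deriv u z * A z = u z * B z) : ∀ᶠ z in 𝓝 (0 : ℂ), u z = 0 := by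
  by_contra hne
  obtain ⟨n, v, hv, hv0, huv⟩ := hu.exists_eventuallyEq_pow_smul_nonzero_iff.mpr hne
  simp only [sub_zero, smul_eq_mul] at huv
  have hn : n ≠ 0 := by
    rintro rfl
    have := huv.self_of_nhds
    simp [hu0] at this
    exact hv0 this.symm
  have hd : ∀ᶠ z in 𝓝 (0 : ℂ), deriv u z = n * z ^ (n - 1) * v z + z ^ n * deriv v z := by
    filter_upwards [huv.eventually_nhds, hv.eventually_analyticAt] with z hz hvz
    rw [EventuallyEq.deriv_eq hz]
    exact ((hasDerivAt_pow n z).fun_mul hvz.differentiableAt.hasDerivAt).deriv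
  have key : ∀ᶠ z in 𝓝[≠] (0 : ℂ), (n * v z + z * deriv v z) * A z = v z * B z := by
    filter_upwards [h, huv.filter_mono nhdsWithin_le_nhds, hd.filter_mono nhdsWithin_le_nhds,
      self_mem_nhdsWithin] with z h1 h2 h3 hz
    have hz : z ≠ 0 := hz
    have e : z ^ n = z * z ^ (n - 1) := by
      rw [← pow_succ', Nat.sub_add_cancel (Nat.pos_of_ne_zero hn)]
    refine mul_left_cancel₀ (pow_ne_zero n hz) ?_
    rw [h2, h3] at h1
    linear_combination h1 + (n * v z * A z) * e
  have hl : Tendsto (fun z => (n * v z + z * deriv v z) * A z) (𝓝[≠] (0 : ℂ))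
      (𝓝 ((n * v 0 + 0 * deriv v 0) * A 0)) := by
    have : ContinuousAt (fun z => (n * v z + z * deriv v z) * A z) 0 :=
      ((continuousAt_const.mul hv.continuousAt).add
        (continuousAt_id.mul hv.deriv.continuousAt)).mul hA
    exact this.tendsto.mono_left nhdsWithin_le_nhds
  have hr : Tendsto (fun z => v z * B z) (𝓝[≠] (0 : ℂ)) (𝓝 (v 0 * B 0)) :=
    (hv.continuousAt.mul hB).tendsto.mono_left nhdsWithin_le_nhds
  have := tendsto_nhds_unique (hl.congr' key) hr
  refine hAB n hn (mul_left_cancel₀ hv0 ?_)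
  linear_combination this

namespace PeriodPair

theorem eventually_notMem_lattice (L : PeriodPair) (x : ℂ) :
    ∀ᶠ z in 𝓝[≠] x, z ∉ L.lattice := by
  filter_upwards [nhdsWithin_le_nhds (L.compl_lattice_sdiff_singleton_mem_nhds x),
    self_mem_nhdsWithin] with z hz hzx hzL
  exact hz ⟨hzL, hzx⟩

theorem weierstrassP_eventuallyEq {L M : PeriodPair} (h2 : L.g₂ = M.g₂) (h3 : L.g₃ = M.g₃) :
    ∀ᶠ z in 𝓝[≠] (0 : ℂ), L.weierstrassP z = M.weierstrassP z := by
  set p := L.weierstrassPExcept 0 with hp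
  set q := M.weierstrassPExcept 0 with hq
  have ep : ∀ z, L.weierstrassP z = p z + 1 / z ^ 2 := fun z => by
    have := L.weierstrassPExcept_add ⟨0, zero_mem _⟩ z
    simp only [sub_zero] at this
    rw [← this]; simp [hp]
  have eq : ∀ z, M.weierstrassP z = q z + 1 / z ^ 2 := fun z => by
    have := M.weierstrassPExcept_add ⟨0, zero_mem _⟩ z
    simp only [sub_zero] at this
    rw [← this]; simp [hq]
  have hpa : AnalyticAt ℂ p 0 := L.analyticAt_weierstrassPExcept 0
  have hqa : AnalyticAt ℂ q 0 := M.analyticAt_weierstrassPExcept 0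
  have dp : ∀ᶠ z in 𝓝[≠] (0 : ℂ), L.derivWeierstrassP z = deriv p z - 2 / z ^ 3 := by
    filter_upwards [L.eventually_notMem_lattice 0] with z hz
    rw [L.eqOn_deriv_weierstrassPExcept_derivWeierstrassPExcept 0 (fun h => hz h.1)]
    have := L.derivWeierstrassPExcept_sub ⟨0, zero_mem _⟩ z
    simpa using this.symm
  have dq : ∀ᶠ z in 𝓝[≠] (0 : ℂ), M.derivWeierstrassP z = deriv q z - 2 / z ^ 3 := by
    filter_upwards [M.eventually_notMem_lattice 0] with z hz
    rw [M.eqOn_deriv_weierstrassPExcept_derivWeierstrassPExcept 0 (fun h => hz h.1)]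
    have := M.derivWeierstrassPExcept_sub ⟨0, zero_mem _⟩ z
    simpa using this.symm
  have p0 : p 0 = 0 := by simpa using (ep 0).symm
  have q0 : q 0 = 0 := by simpa using (eq 0).symm
  have key : ∀ᶠ z in 𝓝 (0 : ℂ), (p - q) z = 0 := by
    refine eventually_eq_zero_of_mul_deriv (hpa.sub hqa) (by simp [p0, q0])
      (A := fun z => z ^ 3 * (deriv p z + deriv q z) - 4)
      (B := fun z => 4 * ((z ^ 2 * p z + 1) ^ 2 + (z ^ 2 * p z + 1) * (z ^ 2 * q z + 1) +
        (z ^ 2 * q z + 1) ^ 2) - L.g₂ * z ^ 4) ?_ ?_ ?_ ?_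
    · have := hpa.deriv.continuousAt
      have := hqa.deriv.continuousAt
      fun_prop
    · have := hpa.continuousAt
      have := hqa.continuousAt
      fun_prop
    · intro n hn h
      norm_num at h
      have : ((n : ℤ) : ℂ) = (-3 : ℤ) := by push_cast; linear_combination (-1 / 4) * h
      have := Int.cast_injective this
      omega
    · filter_upwards [dp, dq, L.eventually_notMem_lattice 0, M.eventually_notMem_lattice 0,
        self_mem_nhdsWithin, hpa.eventually_analyticAt.filter_mono nhdsWithin_le_nhds,
        hqa.eventually_analyticAt.filter_mono nhdsWithin_le_nhds] with z h1 h2' hL hM hz hpz hqz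
      have hz : z ≠ 0 := hz
      have e1 := L.derivWeierstrassP_sq z hL
      have e2 := M.derivWeierstrassP_sq z hM
      rw [h1, ep] at e1
      rw [h2', eq, ← h2, ← h3] at e2
      rw [deriv_sub hpz.differentiableAt hqz.differentiableAt, Pi.sub_apply]
      have e : (deriv p z - deriv q z) * (deriv p z + deriv q z - 4 / z ^ 3) =
          (p z - q z) * (4 * ((p z + 1 / z ^ 2) ^ 2 + (p z + 1 / z ^ 2) * (q z + 1 / z ^ 2) +
            (q z + 1 / z ^ 2) ^ 2) - L.g₂) := by
        linear_combination e1 - e2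
      field_simp at e
      linear_combination e
  filter_upwards [key.filter_mono nhdsWithin_le_nhds] with z hz
  rw [ep, eq, sub_eq_zero.mp hz]

theorem weierstrassP_eq {L M : PeriodPair} (h2 : L.g₂ = M.g₂) (h3 : L.g₃ = M.g₃)
    {z : ℂ} (hL : z ∉ L.lattice) (hM : z ∉ M.lattice) : L.weierstrassP z = M.weierstrassP z := by
  set U : Set ℂ := (L.lattice ∪ M.lattice : Set ℂ)ᶜ with hU
  have hcount : (L.lattice ∪ M.lattice : Set ℂ).Countable :=
    (show Countable L.lattice from L.latticeEquivProd.injective.countable).to_set.union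
      (show Countable M.lattice from M.latticeEquivProd.injective.countable).to_set
  have hpre : IsPreconnected U :=
    (hcount.isConnected_compl_of_one_lt_rank (by simp)).isPreconnected
  have hev : ∀ᶠ x in 𝓝[≠] (0 : ℂ), x ∈ U ∧ ∀ᶠ y in 𝓝 x, L.weierstrassP y = M.weierstrassP y := by
    have h := weierstrassP_eventuallyEq h2 h3
    filter_upwards [eventually_eventually_nhdsWithin.mpr h, L.eventually_notMem_lattice 0,
      M.eventually_notMem_lattice 0, self_mem_nhdsWithin] with x hx h1 h2' hx0
    refine ⟨by simp [hU, h1, h2'], ?_⟩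
    rwa [isOpen_compl_singleton.nhdsWithin_eq hx0] at hx
  obtain ⟨x, hxU, hx⟩ := hev.exists
  have hLa : AnalyticOnNhd ℂ L.weierstrassP U :=
    L.analyticOnNhd_weierstrassP.mono (Set.compl_subset_compl.mpr Set.subset_union_left)
  have hMa : AnalyticOnNhd ℂ M.weierstrassP U :=
    M.analyticOnNhd_weierstrassP.mono (Set.compl_subset_compl.mpr Set.subset_union_right)
  exact hLa.eqOn_of_preconnected_of_eventuallyEq hMa hpre hxU hx (by simp [hU, hL, hM])

theorem lattice_le_of_g_eq {L M : PeriodPair} (h2 : L.g₂ = M.g₂) (h3 : L.g₃ = M.g₃) :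
    L.lattice ≤ M.lattice := by
  intro l hl
  by_contra hM
  have hcong : L.weierstrassP =ᶠ[𝓝[≠] l] M.weierstrassP := by
    filter_upwards [L.eventually_notMem_lattice l, M.eventually_notMem_lattice l] with z h1 h2'
    exact weierstrassP_eq h2 h3 h1 h2'
  have h := L.order_weierstrassP l hl
  rw [meromorphicOrderAt_congr hcong] at h
  have := (M.analyticOnNhd_weierstrassP l hM).meromorphicOrderAt_nonneg
  rw [h] at this
  exact absurd this (by decide)

theorem lattice_eq_of_g_eq {L M : PeriodPair} (h2 : L.g₂ = M.g₂) (h3 : L.g₃ = M.g₃) :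
    L.lattice = M.lattice :=
  le_antisymm (lattice_le_of_g_eq h2 h3) (lattice_le_of_g_eq h2.symm h3.symm)

end PeriodPair

theorem UpperHalfPlane.int_mul_add_int_injective (z : ℍ) {a b c d : ℤ}
    (h : (a : ℂ) * z + b = c * z + d) : a = c ∧ b = d := by
  have h1 := congrArg Complex.im h
  have h2 := congrArg Complex.re h
  simp at h1 h2
  have h3 : a = c := h1.resolve_right z.im_ne_zero
  subst h3
  simpa using h2

/-- The period pair `(c z, c)`. -/
def periodPair (z : ℍ) (c : ℂ) (hc : c ≠ 0) : PeriodPair where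
  ω₁ := c * z
  ω₂ := c
  indep := by
    refine LinearIndependent.pair_iff.mpr fun x y h => ?_
    have h : (x : ℂ) * z + y = 0 := mul_left_cancel₀ hc (by simp at h; linear_combination h)
    have h1 := congrArg Complex.im h
    have h2 := congrArg Complex.re h
    simp at h1 h2
    have h3 : x = 0 := h1.resolve_right z.im_ne_zero
    subst h3
    simpa using h2

theorem periodPair_G (z : ℍ) {c : ℂ} (hc : c ≠ 0) {n : ℕ} (hn : n ≠ 0) :
    (periodPair z c hc).G n = c⁻¹ ^ n *
      ∑' w : {v : ℤ × ℤ // v ≠ 0}, ((w.1.1 : ℂ) * z + (w.1.2 : ℂ)) ^ (-n : ℤ) := by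
  rw [PeriodPair.G, ← (periodPair z c hc).latticeEquivProd.symm.toEquiv.tsum_eq, ← tsum_mul_left]
  symm
  refine (tsum_subtype_eq_of_support_subset (s := {v : ℤ × ℤ | v ≠ 0})
    (f := fun v : ℤ × ℤ => c⁻¹ ^ n * ((v.1 : ℂ) * z + (v.2 : ℂ)) ^ (-n : ℤ)) ?_).trans ?_
  · rintro v hv rfl
    simp [hn] at hv
  · refine tsum_congr fun v => ?_
    have := (periodPair z c hc).latticeEquiv_symm_apply v
    simp only [LinearEquiv.coe_toEquiv, this, zpow_neg, zpow_natCast]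
    rw [show (periodPair z c hc).ω₁ = c * z from rfl, show (periodPair z c hc).ω₂ = c from rfl,
      ← inv_pow, ← inv_pow, ← mul_pow, ← mul_inv]
    congr 2
    ring

theorem exists_scaling {a b a' b' : ℂ} (h : a ^ 3 - 27 * b ^ 2 ≠ 0)
    (h' : a' ^ 3 - 27 * b' ^ 2 ≠ 0) (e : a ^ 3 * b' ^ 2 = a' ^ 3 * b ^ 2) :
    ∃ t : ℂ, t ≠ 0 ∧ t ^ 4 * a = a' ∧ t ^ 6 * b = b' := by
  by_cases ha : a = 0
  · subst ha
    have hb : b ≠ 0 := by rintro rfl; simp at h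
    have ha' : a' = 0 := by simpa [hb] using e.symm
    subst ha'
    have hb' : b' ≠ 0 := by rintro rfl; simp at h'
    obtain ⟨t, ht⟩ := IsAlgClosed.exists_pow_nat_eq (b' / b) (n := 6) (by norm_num)
    refine ⟨t, ?_, by simp, by rw [ht]; field_simp⟩
    rintro rfl
    exact div_ne_zero hb' hb (by simpa using ht.symm)
  by_cases hb : b = 0
  · subst hb
    have hb' : b' = 0 := by simpa [ha] using e
    subst hb'
    have ha' : a' ≠ 0 := by rintro rfl; simp at h'
    obtain ⟨t, ht⟩ := IsAlgClosed.exists_pow_nat_eq (a' / a) (n := 4) (by norm_num)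
    refine ⟨t, ?_, by rw [ht]; field_simp, by simp⟩
    rintro rfl
    exact div_ne_zero ha' ha (by simpa using ht.symm)
  have ha' : a' ≠ 0 := by
    rintro rfl
    have : b' = 0 := by simpa [ha] using e
    simp [this] at h'
  have hb' : b' ≠ 0 := by
    rintro rfl
    simp [ha', hb] at e
  obtain ⟨t, ht⟩ := IsAlgClosed.exists_pow_nat_eq (b' * a / (b * a')) (n := 2) (by norm_num)
  refine ⟨t, ?_, ?_, ?_⟩
  · rintro rfl
    exact div_ne_zero (mul_ne_zero hb' ha) (mul_ne_zero hb ha') (by simpa using ht.symm)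
  · rw [show t ^ 4 = (t ^ 2) ^ 2 by ring, ht]
    field_simp
    linear_combination e
  · rw [show t ^ 6 = (t ^ 2) ^ 3 by ring, ht]
    field_simp
    linear_combination e

theorem exists_smul_eq_of_jC_eq {z w : ℍ} (h : jC z = jC w) : ∃ γ : SL(2, ℤ), γ • z = w := by
  have hz := discC_ne_zero z
  have hw := discC_ne_zero w
  obtain ⟨t, ht, h2, h3⟩ := exists_scaling hz hw (by
    rw [jC, jC, div_eq_div_iff hz hw, discC, discC] at h
    linear_combination (-1 / (27 * 1728)) * h)
  set L := periodPair z t⁻¹ (inv_ne_zero ht)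
  set M := periodPair w 1 one_ne_zero
  have hLM : L.lattice = M.lattice := by
    refine PeriodPair.lattice_eq_of_g_eq ?_ ?_
    · rw [PeriodPair.g₂, PeriodPair.g₂, periodPair_G _ _ (by norm_num),
        periodPair_G _ _ (by norm_num)]
      simp only [g2C] at h2
      simp only [inv_inv, inv_one, one_pow, one_mul, Nat.cast_ofNat]
      linear_combination h2
    · rw [PeriodPair.g₃, PeriodPair.g₃, periodPair_G _ _ (by norm_num),
        periodPair_G _ _ (by norm_num)]
      simp only [g3C] at h3
      simp only [inv_inv, inv_one, one_pow, one_mul, Nat.cast_ofNat]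
      linear_combination h3
  obtain ⟨a, b, hab⟩ := PeriodPair.mem_lattice.mp (hLM ▸ M.ω₁_mem_lattice)
  obtain ⟨c, d, hcd⟩ := PeriodPair.mem_lattice.mp (hLM ▸ M.ω₂_mem_lattice)
  obtain ⟨a', b', hab'⟩ := PeriodPair.mem_lattice.mp (hLM ▸ L.ω₁_mem_lattice)
  obtain ⟨c', d', hcd'⟩ := PeriodPair.mem_lattice.mp (hLM ▸ L.ω₂_mem_lattice)
  simp only [L, M, periodPair, one_mul, mul_one] at hab hcd hab' hcd'
  rw [← hab', ← hcd'] at hab hcd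
  obtain ⟨e1, e2⟩ := w.int_mul_add_int_injective (a := a * a' + b * c') (b := a * b' + b * d')
    (c := 1) (d := 0) (by push_cast; linear_combination hab)
  obtain ⟨e3, e4⟩ := w.int_mul_add_int_injective (a := c * a' + d * c') (b := c * b' + d * d')
    (c := 0) (d := 1) (by push_cast; linear_combination hcd)
  have hdet : (a * d - b * c) * (a' * d' - b' * c') = 1 := by
    linear_combination e1 * (c * b' + d * d') + e4 - e2 * (c * a' + d * c')
  have hz' : (z : ℂ) = t * (a' * w + b') := by rw [hab']; field_simp
  have ht' : t * (c' * w + d') = 1 := by rw [hcd']; field_simp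
  have hden : (c : ℂ) * z + d = t := by
    rw [hz']
    linear_combination t * hcd - d * ht'
  have hnum : (a : ℂ) * z + b = t * w := by
    rw [hz']
    linear_combination t * hab - b * ht'
  have him : 0 < (a * d - b * c : ℝ) := by
    have h0 : w = ((a : ℂ) * z + b) / (c * z + d) := by
      rw [hden, hnum]; field_simp
    have h1 : Complex.normSq t * w.im = (a * d - b * c) * z.im := by
      have h4 : ((a : ℂ) * z + b) * (starRingEnd ℂ) (c * z + d) =
          w * (t * (starRingEnd ℂ) t) := by rw [hden, hnum]; ring
      rw [Complex.mul_conj] at h4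
      have h5 := congrArg Complex.im h4
      simp at h5
      simp only [Complex.normSq_apply] at h5 ⊢
      linear_combination -h5
    have h2 : 0 < Complex.normSq t * w.im := mul_pos (Complex.normSq_pos.mpr ht) w.im_pos
    rw [h1] at h2
    exact (pos_iff_pos_of_mul_pos h2).mpr z.im_pos
  have hpos : 0 < a * d - b * c := by exact_mod_cast him
  have hone : a * d - b * c = 1 := by
    rcases Int.eq_one_or_neg_one_of_mul_eq_one hdet with h | h <;> omega
  let γ : SL(2, ℤ) := ⟨!![a, b; c, d], by rw [Matrix.det_fin_two_of, hone]⟩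
  refine ⟨γ, UpperHalfPlane.ext ?_⟩
  rw [coe_specialLinearGroup_apply]
  simp [γ, hden, hnum, ht]

namespace Mat

theorem isPrimitive_iff {S : Mat} : S.IsPrimitive ↔ ∀ k : ℤ, (∀ i j, k ∣ S i j) → IsUnit k := by
  have h (k : ℕ) : k ∣ Nat.gcd (Nat.gcd (S 0 0).natAbs (S 0 1).natAbs)
      (Nat.gcd (S 1 0).natAbs (S 1 1).natAbs) ↔ ∀ i j, (k : ℤ) ∣ S i j := by
    simp [Nat.dvd_gcd_iff, Int.natCast_dvd, Fin.forall_fin_two, and_assoc]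
  constructor
  · intro hS k hk
    rw [Int.isUnit_iff_natAbs_eq, ← Nat.dvd_one, ← hS, h]
    exact fun i j => Int.natAbs_dvd.mpr (hk i j)
  · intro hS
    exact Int.ofNat_isUnit.mp (hS _ ((h _).mp dvd_rfl)) |> Nat.isUnit_iff.mp

theorem IsPrimitive.coe_mul {S : Mat} (hS : S.IsPrimitive) (M : SL2Z) :
    Mat.IsPrimitive ((M : Mat) * S) := by
  rw [isPrimitive_iff] at hS ⊢
  refine fun k hk => hS k fun i j => ?_
  have : S = ((M⁻¹ : SL2Z) : Mat) * ((M : Mat) * S) := by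
    rw [← Matrix.mul_assoc, ← Matrix.SpecialLinearGroup.coe_mul]
    simp
  rw [this, Matrix.mul_apply]
  exact Finset.dvd_sum fun x _ => (hk x j).mul_left _

theorem det_coe_mul (S : Mat) (M : SL2Z) : ((M : Mat) * S).det = S.det := by simp

end Mat

theorem leftEquiv_equivalence : Equivalence LeftEquiv where
  refl S := ⟨1, by simp⟩
  symm := by
    rintro S T ⟨M, rfl⟩
    refine ⟨M⁻¹, ?_⟩
    rw [← Matrix.mul_assoc, ← Matrix.SpecialLinearGroup.coe_mul]
    simp
  trans := by
    rintro S T U ⟨M, rfl⟩ ⟨N, rfl⟩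
    exact ⟨M * N, by rw [Matrix.SpecialLinearGroup.coe_mul, Matrix.mul_assoc]⟩

theorem moeb_denom_ne_zero {S : Mat} (hS : 0 < S.det) {z : ℂ} (hz : 0 < z.im) :
    (S 1 0 : ℂ) * z + S 1 1 ≠ 0 := by
  intro h
  obtain ⟨h0, h1⟩ := UpperHalfPlane.int_mul_add_int_injective ⟨z, hz⟩ (a := S 1 0) (b := S 1 1)
    (c := 0) (d := 0) (by simpa using h)
  rw [Matrix.det_fin_two, h0, h1] at hS
  simp at hS

theorem moeb_sub_moeb {S : Mat} (hS : 0 < S.det) {z w : ℂ} (hz : 0 < z.im) (hw : 0 < w.im) :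
    moeb S z - moeb S w =
      (z - w) * (S.det / (((S 1 0 : ℂ) * z + S 1 1) * ((S 1 0 : ℂ) * w + S 1 1))) := by
  have h1 := moeb_denom_ne_zero hS hz
  have h2 := moeb_denom_ne_zero hS hw
  rw [moeb, moeb, Matrix.det_fin_two, div_sub_div _ _ h1 h2, ← mul_div_assoc]
  congr 1
  push_cast
  ring

theorem moeb_im {S : Mat} (hS : 0 < S.det) {z : ℂ} (hz : 0 < z.im) :
    (moeb S z).im = S.det * z.im / normSq ((S 1 0 : ℂ) * z + S 1 1) := by
  have h0 := moeb_denom_ne_zero hS hz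
  rw [moeb, Complex.div_im, Matrix.det_fin_two]
  have := Complex.normSq_pos.mpr h0
  field_simp
  simp
  ring

theorem moeb_im_pos {S : Mat} (hS : 0 < S.det) {z : ℂ} (hz : 0 < z.im) : 0 < (moeb S z).im := by
  rw [moeb_im hS hz]
  exact div_pos (mul_pos (by exact_mod_cast hS) hz)
    (Complex.normSq_pos.mpr (moeb_denom_ne_zero hS hz))

theorem moeb_denom_mul {S T : Mat} {z : ℂ} (hT : (T 1 0 : ℂ) * z + T 1 1 ≠ 0) :
    ((S * T) 1 0 : ℂ) * z + (S * T) 1 1 =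
      ((S 1 0 : ℂ) * moeb T z + S 1 1) * ((T 1 0 : ℂ) * z + T 1 1) := by
  simp only [Matrix.mul_apply, Fin.sum_univ_two, moeb]
  push_cast
  field_simp
  ring

theorem moeb_mul {S T : Mat} {z : ℂ} (hT : (T 1 0 : ℂ) * z + T 1 1 ≠ 0) :
    moeb (S * T) z = moeb S (moeb T z) := by
  rw [moeb, moeb_denom_mul hT]
  refine Eq.trans ?_ (mul_div_mul_right _ _ hT)
  congr 1
  simp only [Matrix.mul_apply, Fin.sum_univ_two, moeb]
  push_cast
  field_simp
  ring

theorem moeb_coe (M : SL2Z) (z : ℍ) : moeb M z = (M • z : ℍ) := by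
  rw [coe_specialLinearGroup_apply]
  simp [moeb]

theorem jC_moeb_coe (M : SL2Z) {z : ℂ} (hz : 0 < z.im) : jC (moeb M z) = jC z := by
  have := moeb_coe M ⟨z, hz⟩
  rw [UpperHalfPlane.coe_mk] at this
  rw [this, jC_smul]

theorem jC_moeb_coe_mul (M : SL2Z) {S : Mat} (hS : 0 < S.det) {z : ℂ} (hz : 0 < z.im) :
    jC (moeb ((M : Mat) * S) z) = jC (moeb S z) := by
  rw [moeb_mul (moeb_denom_ne_zero hS hz), jC_moeb_coe M (moeb_im_pos hS hz)]

theorem LeftEquiv.jC_moeb_eq {S T : Mat} (h : LeftEquiv S T) (hT : 0 < T.det) {z : ℂ}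
    (hz : 0 < z.im) : jC (moeb S z) = jC (moeb T z) := by
  obtain ⟨M, rfl⟩ := h
  exact jC_moeb_coe_mul M hT hz

theorem exists_leftEquiv_moeb_eq_self {S : Mat} (hS : 0 < S.det) {z : ℂ} (hz : 0 < z.im)
    (h : jC (moeb S z) = jC z) : ∃ T, LeftEquiv T S ∧ moeb T z = z := by
  obtain ⟨M, hM⟩ := exists_smul_eq_of_jC_eq (z := ⟨moeb S z, moeb_im_pos hS hz⟩) (w := ⟨z, hz⟩) h
  refine ⟨M * S, ⟨M, rfl⟩, ?_⟩
  rw [moeb_mul (moeb_denom_ne_zero hS hz)]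
  have := moeb_coe M ⟨moeb S z, moeb_im_pos hS hz⟩
  rwa [hM] at this

/-- A primitive matrix of determinant at least two that fixes a point of the upper half-plane is
not triangular. -/
theorem Mat.IsPrimitive.lower_left_ne_zero {S : Mat} (hp : S.IsPrimitive) (hS : 1 < S.det) {z : ℂ}
    (hz : 0 < z.im) (h : moeb S z = z) : S 1 0 ≠ 0 := by
  intro h0
  have hd := moeb_denom_ne_zero (zero_lt_one.trans hS) hz
  rw [moeb, div_eq_iff hd, h0] at h
  obtain ⟨h1, h2⟩ := UpperHalfPlane.int_mul_add_int_injective ⟨z, hz⟩ (a := S 0 0) (b := S 0 1)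
    (c := S 1 1) (d := 0) (by push_cast at h ⊢; exact h.trans (by ring))
  have hu := Mat.isPrimitive_iff.mp hp (S 1 1) (by simp [Fin.forall_fin_two, h0, h1, h2])
  rw [Matrix.det_fin_two, h0, h1, h2] at hS
  rcases Int.isUnit_iff.mp hu with h | h <;> simp [h] at hS

theorem moeb_denom_sq_ne_det {S : Mat} (hp : S.IsPrimitive) (hS : 1 < S.det) {z : ℂ}
    (hz : 0 < z.im) (h : moeb S z = z) : ((S 1 0 : ℂ) * z + S 1 1) ^ 2 ≠ S.det := by
  intro hsq
  have hc := hp.lower_left_ne_zero hS hz h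
  have hd := moeb_denom_ne_zero (zero_lt_one.trans hS) hz
  rw [moeb, div_eq_iff hd] at h
  set w := (S 1 0 : ℂ) * z + S 1 1 with hw
  have hwim : w.im ≠ 0 := by
    simp [hw, hc, hz.ne']
  have hdet := Matrix.det_fin_two S
  -- `w` is an eigenvalue of `S`
  have hch : w ^ 2 - (S 0 0 + S 1 1) * w + S.det = 0 := by
    rw [hdet]; push_cast
    rw [hw] at h ⊢
    linear_combination (-(S 1 0 : ℂ)) * h
  have h1 := congrArg Complex.im hsq
  have h2 := congrArg Complex.re hsq
  simp only [sq, Complex.mul_im, Complex.mul_re, Complex.intCast_im, Complex.intCast_re] at h1 h2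
  have hre : w.re = 0 := by
    have : w.re * w.im = 0 := by linarith
    exact (mul_eq_zero.mp this).resolve_right hwim
  rw [hre] at h2
  have : (0 : ℝ) < S.det := by exact_mod_cast zero_lt_one.trans hS
  nlinarith [mul_self_nonneg w.im]

theorem finrank_adjoin_of_moeb_eq_self {S : Mat} (hp : S.IsPrimitive) (hS : 1 < S.det) {z : ℂ}
    (hz : 0 < z.im) (h : moeb S z = z) : Module.finrank ℚ ℚ⟮z⟯ = 2 := by
  have hc := hp.lower_left_ne_zero hS hz h
  have hd := moeb_denom_ne_zero (zero_lt_one.trans hS) hz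
  rw [moeb, div_eq_iff hd] at h
  set p : ℚ[X] := C (S 1 0 : ℚ) * X ^ 2 + C ((S 1 1 - S 0 0 : ℤ) : ℚ) * X + C ((-S 0 1 : ℤ) : ℚ)
  have hpd : p.natDegree = 2 := natDegree_quadratic (by exact_mod_cast hc)
  have hp0 : p ≠ 0 := by intro h; simp [h] at hpd
  have hpz : aeval z p = 0 := by
    simp [p]
    linear_combination -h
  have hint : IsIntegral ℚ z := (isAlgebraic_iff_isIntegral).mp ⟨p, hp0, hpz⟩
  rw [IntermediateField.adjoin.finrank hint]
  refine le_antisymm (hpd ▸ natDegree_le_of_dvd (minpoly.dvd ℚ z hpz) hp0) ?_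
  rw [minpoly.two_le_natDegree_iff hint]
  rintro ⟨q, rfl⟩
  simp at hz

theorem analyticOrderAt_comp_sub_self {f w k : ℂ → ℂ} {x : ℂ} {e : ℕ} (hf : AnalyticAt ℂ f x)
    (he : analyticOrderAt (fun z => f z - f x) x = e) (hk : AnalyticAt ℂ k x)
    (hw : ∀ᶠ z in 𝓝 x, w z - x = (z - x) * k z) (hke : k x ^ e ≠ 1) :
    analyticOrderAt (fun z => f (w z) - f z) x = e := by
  have hwx : w x = x := by simpa [sub_eq_zero] using hw.self_of_nhds
  have hw' : w =ᶠ[𝓝 x] fun z => (z - x) * k z + x := by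
    filter_upwards [hw] with z hz
    rw [← hz]; ring
  have hwa : AnalyticAt ℂ w x :=
    (((analyticAt_id.sub analyticAt_const).mul hk).add analyticAt_const).congr hw'.symm
  have hf0 : AnalyticAt ℂ (fun z => f z - f x) x := hf.sub analyticAt_const
  have hfw : AnalyticAt ℂ (fun z => f (w z)) x := AnalyticAt.fun_comp (by rwa [hwx]) hwa
  obtain ⟨g, hg, hg0, hfg⟩ := hf0.analyticOrderAt_eq_natCast.mp he
  have hgw : AnalyticAt ℂ (fun z => g (w z)) x := AnalyticAt.fun_comp (by rwa [hwx]) hwa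
  refine (hfw.sub hf).analyticOrderAt_eq_natCast.mpr
    ⟨fun z => k z ^ e * g (w z) - g z, ((hk.pow e).mul hgw).sub hg, ?_, ?_⟩
  · change k x ^ e * g (w x) - g x ≠ 0
    rw [hwx, ← sub_one_mul]
    exact mul_ne_zero (sub_ne_zero.mpr hke) hg0
  · have hwt : Tendsto w (𝓝 x) (𝓝 x) := by simpa [hwx] using hwa.continuousAt.tendsto
    filter_upwards [hfg, hwt.eventually hfg, hw] with z h1 h2 h3
    rw [h3] at h2
    simp only [smul_eq_mul, mul_pow, Pi.sub_apply] at *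
    linear_combination h2 - h1

/-- Near a point where `f - f x` vanishes to order `e`, multiplication of the local coordinate by
an `e`-th root of unity lifts to a local self-map of the source commuting with `f`. -/
theorem exists_hasDerivAt_comp_eq {f : ℂ → ℂ} {x μ : ℂ} {e : ℕ} (hf : AnalyticAt ℂ f x)
    (he : analyticOrderAt (fun z => f z - f x) x = e) (he0 : e ≠ 0) (hμ : μ ^ e = 1) :
    ∃ w : ℂ → ℂ, w x = x ∧ HasDerivAt w μ x ∧ ∀ᶠ z in 𝓝 x, f (w z) = f z := by
  have hf0 : AnalyticAt ℂ (fun z => f z - f x) x := hf.sub analyticAt_const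
  obtain ⟨g, hg, hg0, hfg⟩ := hf0.analyticOrderAt_eq_natCast.mp he
  obtain ⟨c, hc⟩ := IsAlgClosed.exists_pow_nat_eq (g x) (Nat.pos_of_ne_zero he0)
  have hc0 : c ≠ 0 := by
    rintro rfl
    exact hg0 (by rw [← hc, zero_pow he0])
  set G : ℂ → ℂ := fun z => c * (g z / g x) ^ (e⁻¹ : ℂ) with hG
  have hGa : AnalyticAt ℂ G x :=
    analyticAt_const.mul ((hg.div analyticAt_const hg0).cpow analyticAt_const (by simp [hg0]))
  have hGx : G x = c := by simp [hG, hg0]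
  have hGe (z : ℂ) : G z ^ e = g z := by
    rw [hG, mul_pow, cpow_nat_inv_pow _ he0, hc]
    field_simp
  set h : ℂ → ℂ := fun z => (z - x) * G z with hh
  have hha : AnalyticAt ℂ h x := (analyticAt_id.sub analyticAt_const).mul hGa
  have hhx : h x = 0 := by simp [hh]
  have hhd : HasDerivAt h c x := by
    have := ((hasDerivAt_id x).sub_const x).fun_mul hGa.differentiableAt.hasDerivAt
    simpa [hGx] using this
  have hhs : HasStrictDerivAt h c x := hhd.deriv ▸ hha.hasStrictDerivAt
  set φ := hhs.localInverse h c x hc0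
  have hφ : HasStrictDerivAt φ c⁻¹ (h x) := hhs.to_localInverse hc0
  have hφr : ∀ᶠ y in 𝓝 (h x), h (φ y) = y := hhs.eventually_right_inverse hc0
  have hφl : ∀ᶠ y in 𝓝 x, φ (h y) = y := hhs.eventually_left_inverse hc0
  have hφx : φ (h x) = x := hφl.self_of_nhds
  have hfh : ∀ᶠ z in 𝓝 x, f z - f x = h z ^ e := by
    filter_upwards [hfg] with z hz
    rw [hz, hh, mul_pow, hGe, smul_eq_mul]
  have hμh : HasDerivAt (fun z => μ * h z) (μ * c) x := hhd.const_mul μ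
  have hμhx : μ * h x = h x := by simp [hhx]
  have hw : HasDerivAt (fun z => φ (μ * h z)) μ x := by
    have := HasDerivAt.comp x (h₂ := φ) (h := fun z => μ * h z) (by
      simpa [hμhx] using hφ.hasDerivAt) hμh
    have e1 : c⁻¹ * (μ * c) = μ := by field_simp
    rwa [e1] at this
  have hwx : φ (μ * h x) = x := by rw [hμhx, hφx]
  refine ⟨_, hwx, hw, ?_⟩
  have ht1 : Tendsto (fun z => μ * h z) (𝓝 x) (𝓝 (h x)) := by
    simpa [hμhx] using hμh.continuousAt.tendsto
  have ht2 : Tendsto (fun z => φ (μ * h z)) (𝓝 x) (𝓝 x) := by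
    simpa [hwx] using hw.continuousAt.tendsto
  filter_upwards [ht1.eventually hφr, ht2.eventually hfh, hfh] with z h1 h2 h3
  rw [h1, mul_pow, hμ, one_mul, ← h3] at h2
  exact sub_left_inj.mp h2

theorem analyticAt_jC {z : ℂ} (hz : 0 < z.im) : AnalyticAt ℂ jC z :=
  differentiableOn_jC.analyticAt ((isOpen_lt continuous_const Complex.continuous_im).mem_nhds hz)

theorem hasDerivAt_moeb {S : Mat} (hS : 0 < S.det) {z : ℂ} (hz : 0 < z.im) :
    HasDerivAt (moeb S) (S.det / ((S 1 0 : ℂ) * z + S 1 1) ^ 2) z := by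
  have hd := moeb_denom_ne_zero hS hz
  have h1 : HasDerivAt (fun z : ℂ => (S 0 0 : ℂ) * z + S 0 1) (S 0 0) z := by
    simpa using ((hasDerivAt_id z).const_mul (S 0 0 : ℂ)).add_const (S 0 1 : ℂ)
  have h2 : HasDerivAt (fun z : ℂ => (S 1 0 : ℂ) * z + S 1 1) (S 1 0) z := by
    simpa using ((hasDerivAt_id z).const_mul (S 1 0 : ℂ)).add_const (S 1 1 : ℂ)
  refine (h1.fun_div h2 hd).congr_deriv ?_
  rw [Matrix.det_fin_two]
  congr 1
  push_cast
  ring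

theorem moeb_eventually_mem {w : ℂ → ℂ} {ρ : ℍ} (hw : ContinuousAt w ρ) (hwρ : w ρ = ρ)
    (hj : ∀ᶠ z in 𝓝 (ρ : ℂ), jC (w z) = jC z) :
    ∃ M : SL2Z, ∃ᶠ z in 𝓝[≠] (ρ : ℂ), moeb M z = w z := by
  obtain ⟨K, hK, hρK⟩ := exists_compact_mem_nhds ρ
  have hfin := ProperlyDiscontinuousSMul.finite_disjoint_inter_image (Γ := 𝒮ℒ) hK hK
  have hKρ : ∀ᶠ z in 𝓝 (ρ : ℂ), ∃ u ∈ K, (u : ℂ) = z := by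
    have := isOpenEmbedding_coe.image_mem_nhds.mpr hρK
    filter_upwards [this] with z hz
    exact hz
  have hwt : Tendsto w (𝓝 (ρ : ℂ)) (𝓝 (ρ : ℂ)) := by simpa [hwρ] using hw.tendsto
  by_contra! hM
  have hall : ∀ᶠ z in 𝓝[≠] (ρ : ℂ), ∀ g ∈ {γ : 𝒮ℒ | ((γ • ·) '' K ∩ K).Nonempty},
      ∀ M : SL2Z, (M : GL (Fin 2) ℝ) = g → moeb M z ≠ w z := by
    refine (eventually_all_finite hfin).mpr fun g _ => ?_
    obtain ⟨M, hMg⟩ := g.2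
    filter_upwards [hM M] with z hz M' hM'
    have : M' = M := by
      apply Matrix.SpecialLinearGroup.mapGL_injective (R := ℤ) (S := ℝ)
      exact hM'.trans hMg.symm
    rwa [this]
  have := hall.and ((hKρ.and ((hwt.eventually hKρ).and hj)).filter_mono nhdsWithin_le_nhds)
  obtain ⟨z, hz, ⟨u, huK, rfl⟩, ⟨v, hvK, hv⟩, hjz⟩ := this.exists
  rw [← hv] at hjz
  obtain ⟨M, hM⟩ := exists_smul_eq_of_jC_eq hjz.symm
  refine hz ⟨M, M, rfl⟩ ⟨v, ⟨u, huK, hM⟩, hvK⟩ M rfl ?_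
  rw [moeb_coe, hM, hv]

theorem exists_moeb_fixed_of_hasDerivAt {w : ℂ → ℂ} {ρ μ : ℂ} (hρ : 0 < ρ.im)
    (hw : HasDerivAt w μ ρ) (hwρ : w ρ = ρ) (hj : ∀ᶠ z in 𝓝 ρ, jC (w z) = jC z) :
    ∃ M : SL2Z, moeb M ρ = ρ ∧ μ = 1 / ((M 1 0 : ℂ) * ρ + M 1 1) ^ 2 := by
  obtain ⟨M, hM⟩ := moeb_eventually_mem (ρ := ⟨ρ, hρ⟩) hw.continuousAt hwρ hj
  have hdet : (M : Mat).det = 1 := M.2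
  have hd := hasDerivAt_moeb (S := M) (by simp) hρ
  have hM : ∃ᶠ z in 𝓝[≠] ρ, moeb M z = w z := hM
  have hfix : moeb M ρ = w ρ :=
    tendsto_nhds_unique_of_frequently_eq (hd.continuousAt.tendsto.mono_left nhdsWithin_le_nhds)
      (hw.continuousAt.tendsto.mono_left nhdsWithin_le_nhds) hM
  refine ⟨M, hfix.trans hwρ, ?_⟩
  rw [hasDerivAt_iff_tendsto_slope] at hd hw
  have := tendsto_nhds_unique_of_frequently_eq hw hd (hM.mono fun z hz => by
    simp only [slope_def_field, hz, hfix])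
  rw [this, hdet]
  simp

theorem analyticOrderAt_jC_ne_top {ρ : ℂ} (hρ : 0 < ρ.im) :
    analyticOrderAt (fun z => jC z - jC ρ) ρ ≠ ⊤ := by
  intro h
  rw [analyticOrderAt_eq_top] at h
  have hU : IsPreconnected {z : ℂ | 0 < z.im} := (convex_halfSpace_im_gt 0).isPreconnected
  have ha : AnalyticOnNhd ℂ jC {z : ℂ | 0 < z.im} := fun z hz => analyticAt_jC hz
  have heq := ha.eqOn_of_preconnected_of_eventuallyEq (analyticOnNhd_const (v := jC ρ)) hU hρ
    (h.mono fun z hz => sub_eq_zero.mp hz)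
  obtain ⟨z, hz⟩ := exists_jC_eq (jC ρ + 1)
  have := heq z.im_pos
  rw [hz] at this
  simp at this

/-- For a non-trivial primitive matrix `S` fixing `ρ`, the function `j ∘ S - j` vanishes at `ρ` to
the same order as `j - j ρ`. -/
theorem analyticOrderAt_jC_moeb_sub {S : Mat} (hp : S.IsPrimitive) (hS : 1 < S.det) {ρ : ℂ}
    (hρ : 0 < ρ.im) (h : moeb S ρ = ρ) :
    analyticOrderAt (fun z => jC (moeb S z) - jC z) ρ =
      analyticOrderAt (fun z => jC z - jC ρ) ρ := by
  have hS0 : 0 < S.det := zero_lt_one.trans hS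
  obtain ⟨e, he⟩ := ENat.ne_top_iff_exists.mp (analyticOrderAt_jC_ne_top hρ)
  have hj := analyticAt_jC hρ
  have he0 : e ≠ 0 := by
    have : analyticOrderAt (fun z => jC z - jC ρ) ρ ≠ 0 :=
      analyticOrderAt_ne_zero.mpr ⟨hj.sub analyticAt_const, sub_self _⟩
    rw [← he] at this
    exact_mod_cast this
  have hd := moeb_denom_ne_zero hS0 hρ
  rw [← he]
  refine analyticOrderAt_comp_sub_self hj he.symm
    (k := fun z => S.det / (((S 1 0 : ℂ) * z + S 1 1) * ((S 1 0 : ℂ) * ρ + S 1 1))) ?_ ?_ ?_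
  · refine analyticAt_const.div ?_ (mul_ne_zero hd hd)
    fun_prop
  · filter_upwards [(isOpen_lt continuous_const Complex.continuous_im).mem_nhds hρ] with z hz
    rw [← moeb_sub_moeb hS0 hz hρ, h]
  intro hμ
  obtain ⟨w, hwρ, hw, hwj⟩ := exists_hasDerivAt_comp_eq hj he.symm he0 hμ
  obtain ⟨M, hM, hMd⟩ := exists_moeb_fixed_of_hasDerivAt hρ hw hwρ hwj
  have hMd0 : ((M : Mat) 1 0 : ℂ) * ρ + (M : Mat) 1 1 ≠ 0 := moeb_denom_ne_zero (by simp) hρ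
  -- `T = M⁻¹ S` fixes `ρ` with multiplier one
  set T : Mat := ((M⁻¹ : SL2Z) : Mat) * S with hT
  have hST : (M : Mat) * T = S := by
    rw [hT, ← Matrix.mul_assoc, ← Matrix.SpecialLinearGroup.coe_mul]
    simp
  have hTp : T.IsPrimitive := hp.coe_mul _
  have hTdet : T.det = S.det := Mat.det_coe_mul _ _
  have hTd : (T 1 0 : ℂ) * ρ + T 1 1 ≠ 0 := moeb_denom_ne_zero (hTdet ▸ hS0) hρ
  have hMinv : moeb ((M⁻¹ : SL2Z) : Mat) ρ = ρ := by
    conv_lhs => rw [← hM]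
    rw [← moeb_mul hMd0, ← Matrix.SpecialLinearGroup.coe_mul]
    simp [moeb]
  have hTρ : moeb T ρ = ρ := by rw [hT, moeb_mul hd, h, hMinv]
  have hden := moeb_denom_mul (S := (M : Mat)) hTd
  rw [hST, hTρ] at hden
  refine moeb_denom_sq_ne_det hTp (hTdet ▸ hS) hρ hTρ ?_
  rw [hTdet]
  rw [hden, div_eq_div_iff (mul_ne_zero (mul_ne_zero hMd0 hTd) (mul_ne_zero hMd0 hTd))
    (pow_ne_zero 2 hMd0)] at hMd
  refine mul_left_cancel₀ (pow_ne_zero 2 hMd0) ?_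
  linear_combination -hMd

theorem Nat.eq_and_eq_of_sq_mul_squarefree_eq {t d t' d' : ℕ} (hd : Squarefree d)
    (hd' : Squarefree d') (ht : t ≠ 0) (ht' : t' ≠ 0) (h : t ^ 2 * d = t' ^ 2 * d') :
    t = t' ∧ d = d' := by
  have key : t = t' := by
    refine Nat.eq_of_factorization_eq ht ht' fun p => ?_
    have h1 := congrArg (fun n => n.factorization p) h
    simp only [Nat.factorization_mul (pow_ne_zero 2 ht) hd.ne_zero,
      Nat.factorization_mul (pow_ne_zero 2 ht') hd'.ne_zero, Nat.factorization_pow,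
      Finsupp.add_apply, Finsupp.smul_apply, smul_eq_mul] at h1
    have h2 := hd.natFactorization_le_one p
    have h3 := hd'.natFactorization_le_one p
    omega
  subst key
  exact ⟨rfl, Nat.eq_of_mul_eq_mul_left (pow_pos (Nat.pos_of_ne_zero ht) 2) h⟩

/-- The divisors of `n` whose square divides `n`. -/
def sqDivisors (n : ℕ) : Finset ℕ := n.divisors.filter fun t => t ^ 2 ∣ n

theorem mem_sqDivisors {n t : ℕ} (hn : n ≠ 0) : t ∈ sqDivisors n ↔ t ^ 2 ∣ n := by
  simp only [sqDivisors, Finset.mem_filter, Nat.mem_divisors, hn, ne_eq, not_false_eq_true,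
    and_true, and_iff_right_iff_imp]
  exact (dvd_pow_self t two_ne_zero).trans

theorem sum_psi_div_sq {n : ℕ} (hn : n ≠ 0) :
    ∑ t ∈ sqDivisors n, psi (n / t ^ 2) = ∑ d ∈ n.divisors, d := by
  rw [← Nat.sum_div_divisors n fun d => d]
  simp only [psi, ← Finset.sum_filter]
  rw [Finset.sum_sigma']
  refine Finset.sum_bij (fun x _ => x.1 ^ 2 * x.2) ?_ ?_ ?_ ?_
  · rintro ⟨t, d⟩ h
    simp only [Finset.mem_sigma, mem_sqDivisors hn, Finset.mem_filter, Nat.mem_divisors] at h ⊢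
    exact ⟨Nat.mul_dvd_of_dvd_div h.1 h.2.1.1, hn⟩
  · rintro ⟨t, d⟩ h ⟨t', d'⟩ h' heq
    simp only [Finset.mem_sigma, mem_sqDivisors hn, Finset.mem_filter, Nat.mem_divisors] at h h'
    have ht : t ≠ 0 := by rintro rfl; simp [hn] at h
    have ht' : t' ≠ 0 := by rintro rfl; simp [hn] at h'
    obtain ⟨rfl, rfl⟩ := Nat.eq_and_eq_of_sq_mul_squarefree_eq h.2.2 h'.2.2 ht ht' heq
    rfl
  · intro m hm
    obtain ⟨d, t, rfl, hd⟩ := Nat.sq_mul_squarefree m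
    have hdvd := Nat.dvd_of_mem_divisors hm
    have ht2 : t ^ 2 ∣ n := (Dvd.intro _ rfl).trans hdvd
    refine ⟨⟨t, d⟩, ?_, rfl⟩
    simp only [Finset.mem_sigma, mem_sqDivisors hn, Finset.mem_filter, Nat.mem_divisors]
    have ht0 : 0 < t ^ 2 := Nat.pos_of_dvd_of_pos ht2 (Nat.pos_of_ne_zero hn)
    refine ⟨ht2, ⟨(Nat.dvd_div_iff_mul_dvd ht2).mpr hdvd, ?_⟩, hd⟩
    exact (Nat.div_pos (Nat.le_of_dvd (Nat.pos_of_ne_zero hn) ht2) ht0).ne'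
  · rintro ⟨t, d⟩ _
    exact Nat.div_div_eq_div_mul _ _ _

/-- Pairs `⟨d, b⟩` encoding the primitive triangular matrices `(n / d, b; 0, d)` with
`0 ≤ b < d`. -/
def primPairs (n : ℕ) : Finset (Σ _ : ℕ, ℕ) :=
  n.divisors.sigma fun d => (Finset.range d).filter fun b => Nat.gcd (Nat.gcd (n / d) b) d = 1

theorem sum_card_primPairs_div_sq {n : ℕ} (hn : n ≠ 0) :
    ∑ t ∈ sqDivisors n, (primPairs (n / t ^ 2)).card = ∑ d ∈ n.divisors, d := by
  set A : Finset (Σ _ : ℕ, ℕ) := n.divisors.sigma fun d => Finset.range d with hA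
  have hcard : A.card = ∑ d ∈ n.divisors, d := by simp [hA, Finset.card_sigma]
  set f : (Σ _ : ℕ, ℕ) → ℕ := fun x => Nat.gcd (Nat.gcd (n / x.1) x.2) x.1 with hf
  have hmaps : ∀ x ∈ A, f x ∈ sqDivisors n := by
    rintro ⟨d, b⟩ hx
    simp only [hA, Finset.mem_sigma, Nat.mem_divisors, Finset.mem_range] at hx
    rw [mem_sqDivisors hn, sq]
    have := mul_dvd_mul ((Nat.gcd_dvd_left (Nat.gcd (n / d) b) d).trans (Nat.gcd_dvd_left _ _))
      (Nat.gcd_dvd_right (Nat.gcd (n / d) b) d)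
    rwa [Nat.div_mul_cancel hx.1.1] at this
  rw [← hcard, Finset.card_eq_sum_card_fiberwise hmaps]
  refine Finset.sum_congr rfl fun t ht => ?_
  rw [mem_sqDivisors hn] at ht
  obtain ⟨m, rfl⟩ := ht
  have ht0 : 0 < t := Nat.pos_of_ne_zero (by rintro rfl; simp at hn)
  have hm0 : m ≠ 0 := by rintro rfl; simp at hn
  rw [Nat.mul_div_cancel_left _ (pow_pos ht0 2)]
  have hdiv {d : ℕ} (hd : d ∣ m) : t ^ 2 * m / (t * d) = t * (m / d) := by
    obtain ⟨k, rfl⟩ := hd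
    have hd0 : 0 < d := Nat.pos_of_ne_zero (by rintro rfl; simp at hm0)
    rw [Nat.mul_div_cancel_left _ hd0, show t ^ 2 * (d * k) = t * d * (t * k) by ring,
      Nat.mul_div_cancel_left _ (Nat.mul_pos ht0 hd0)]
  refine Finset.card_bij (fun x _ => ⟨t * x.1, t * x.2⟩) ?_ ?_ ?_
  · rintro ⟨d, b⟩ hx
    simp only [primPairs, hA, hf, Finset.mem_sigma, Finset.mem_filter, Nat.mem_divisors,
      Finset.mem_range] at hx ⊢
    obtain ⟨⟨hd, -⟩, hb, hg⟩ := hx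
    refine ⟨⟨⟨?_, hn⟩, Nat.mul_lt_mul_of_pos_left hb ht0⟩, ?_⟩
    · rw [sq, mul_assoc]
      exact mul_dvd_mul_left t (hd.mul_left t)
    · rw [hdiv hd, Nat.gcd_mul_left, Nat.gcd_mul_left, hg, mul_one]
  · rintro ⟨d, b⟩ _ ⟨d', b'⟩ _ h
    simpa [ht0.ne'] using h
  · rintro ⟨d, b⟩ hx
    simp only [hA, hf, Finset.mem_sigma, Finset.mem_filter, Nat.mem_divisors,
      Finset.mem_range] at hx
    obtain ⟨⟨⟨hd, -⟩, hb⟩, hg⟩ := hx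
    have h1 : t ∣ d := (dvd_of_eq hg.symm).trans (Nat.gcd_dvd_right _ _)
    have h2 : t ∣ b :=
      (dvd_of_eq hg.symm).trans ((Nat.gcd_dvd_left _ _).trans (Nat.gcd_dvd_right _ _))
    have h3 : t ∣ t ^ 2 * m / d :=
      (dvd_of_eq hg.symm).trans ((Nat.gcd_dvd_left _ _).trans (Nat.gcd_dvd_left _ _))
    obtain ⟨d, rfl⟩ := h1
    obtain ⟨b, rfl⟩ := h2
    obtain ⟨a, ha⟩ := h3
    have hda : m = d * a := by
      have := Nat.div_mul_cancel hd
      rw [ha] at this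
      refine Nat.eq_of_mul_eq_mul_left (pow_pos ht0 2) ?_
      rw [← this]; ring
    have hdm : d ∣ m := Dvd.intro _ hda.symm
    refine ⟨⟨d, b⟩, ?_, rfl⟩
    simp only [primPairs, Finset.mem_sigma, Finset.mem_filter, Nat.mem_divisors, Finset.mem_range]
    refine ⟨⟨hdm, hm0⟩, Nat.lt_of_mul_lt_mul_left hb, ?_⟩
    rw [hdiv hdm, Nat.gcd_mul_left, Nat.gcd_mul_left] at hg
    exact Nat.eq_of_mul_eq_mul_left ht0 (hg.trans (mul_one t).symm)

theorem card_primPairs {n : ℕ} (hn : n ≠ 0) : (primPairs n).card = psi n := by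
  induction n using Nat.strong_induction_on with
  | _ n ih =>
    have h := (sum_card_primPairs_div_sq hn).trans (sum_psi_div_sq hn).symm
    have h1 : 1 ∈ sqDivisors n := (mem_sqDivisors hn).mpr (by simp)
    have key : ∑ t ∈ (sqDivisors n).erase 1, (primPairs (n / t ^ 2)).card =
        ∑ t ∈ (sqDivisors n).erase 1, psi (n / t ^ 2) := by
      refine Finset.sum_congr rfl fun t ht => ?_
      obtain ⟨ht1, ht⟩ := Finset.mem_erase.mp ht
      have ht2 := (mem_sqDivisors hn).mp ht
      have ht0 : 0 < t ^ 2 := Nat.pos_of_dvd_of_pos ht2 (Nat.pos_of_ne_zero hn)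
      have ht3 : 1 < t ^ 2 := by
        refine lt_of_le_of_ne ht0 fun h => ht1 ?_
        simpa using h.symm
      exact ih _ (Nat.div_lt_self (Nat.pos_of_ne_zero hn) ht3)
        (Nat.div_pos (Nat.le_of_dvd (Nat.pos_of_ne_zero hn) ht2) ht0).ne'
    rw [← Finset.add_sum_erase _ _ h1, ← Finset.add_sum_erase _ _ h1, key] at h
    simpa using h

theorem exists_leftEquiv_triangular {T : Mat} (hT : 0 < T.det) :
    ∃ a b d : ℕ, b < d ∧ LeftEquiv T !![(a : ℤ), b; 0, d] := by
  have hdet := Matrix.det_fin_two T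
  have hg : 0 < Int.gcd (T 0 0) (T 1 0) := by
    refine Nat.pos_of_ne_zero fun h => ?_
    obtain ⟨h0, h1⟩ := Int.gcd_eq_zero_iff.mp h
    rw [hdet, h0, h1] at hT
    simp at hT
  set g := Int.gcd (T 0 0) (T 1 0)
  obtain ⟨p, hp⟩ : (g : ℤ) ∣ T 0 0 := Int.gcd_dvd_left ..
  obtain ⟨q, hq⟩ : (g : ℤ) ∣ T 1 0 := Int.gcd_dvd_right ..
  have hbez : (g : ℤ) = T 0 0 * Int.gcdA (T 0 0) (T 1 0) + T 1 0 * Int.gcdB (T 0 0) (T 1 0) :=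
    Int.gcd_eq_gcd_ab _ _
  set u := Int.gcdA (T 0 0) (T 1 0)
  set v := Int.gcdB (T 0 0) (T 1 0)
  have hg0 : (g : ℤ) ≠ 0 := by exact_mod_cast hg.ne'
  have huv : p * u + q * v = 1 := by
    refine mul_left_cancel₀ hg0 ?_
    rw [hp, hq] at hbez
    linear_combination -hbez
  set d := p * T 1 1 - q * T 0 1 with hd
  have hgd : T.det = g * d := by rw [hdet, hp, hq, hd]; ring
  have hd0 : 0 < d := by
    rw [hgd] at hT
    exact (pos_iff_pos_of_mul_pos hT).mp (by exact_mod_cast hg)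
  set b := u * T 0 1 + v * T 1 1 with hb
  have hmod := Int.emod_add_mul_ediv b d
  have hm0 := Int.emod_nonneg b hd0.ne'
  have hm1 := Int.emod_lt_of_pos b hd0
  set k := b / d
  set r := b % d
  refine ⟨g, r.toNat, d.toNat, by omega, ?_⟩
  rw [Int.toNat_of_nonneg hm0, Int.toNat_of_nonneg hd0.le]
  let M : SL2Z := ⟨!![p, p * k - v; q, q * k + u], by
    rw [Matrix.det_fin_two_of]; linear_combination huv⟩
  refine ⟨M, ?_⟩
  ext i j
  fin_cases i <;> fin_cases j
  · simp [M, hp, mul_comm]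
  · simp [M]
    linear_combination (-p) * hmod - (T 0 1) * huv - p * hb + v * hd
  · simp [M, hq, mul_comm]
  · simp [M]
    linear_combination (-q) * hmod - (T 1 1) * huv - q * hb - u * hd

theorem eq_of_leftEquiv_triangular {a b d a' b' d' : ℕ} (ha : 0 < a) (ha' : 0 < a')
    (had : a * d = a' * d') (hb : b < d) (hb' : b' < d')
    (h : LeftEquiv !![(a : ℤ), b; 0, d] !![(a' : ℤ), b'; 0, d']) : d = d' ∧ b = b' := by
  obtain ⟨M, hM⟩ := h
  have h00 := congrFun (congrFun hM 0) 0
  have h01 := congrFun (congrFun hM 0) 1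
  have h10 := congrFun (congrFun hM 1) 0
  have h11 := congrFun (congrFun hM 1) 1
  have hdet := M.2
  rw [Matrix.det_fin_two] at hdet
  simp [Matrix.mul_apply, Fin.sum_univ_two] at h00 h01 h10 h11
  have h10 : M 1 0 = 0 := h10.resolve_right ha'.ne'
  have e : M 0 0 * M 1 1 = 1 := by
    have : (M.1 1 0) = 0 := h10
    rw [this] at hdet
    simpa using hdet
  have hpos : 0 < M 0 0 := by
    have : 0 < M 0 0 * (a' : ℤ) := by rw [← h00]; exact_mod_cast ha
    exact (pos_iff_pos_of_mul_pos this).mpr (by exact_mod_cast ha')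
  have e0 : M 0 0 = 1 := by
    rcases Int.eq_one_or_neg_one_of_mul_eq_one e with h | h <;> omega
  have e1 : M 1 1 = 1 := by simpa [e0] using e
  rw [h10, e1] at h11
  rw [e0] at h01
  have hdd : d = d' := by
    have : (d : ℤ) = d' := by simpa using h11
    exact_mod_cast this
  subst hdd
  refine ⟨rfl, ?_⟩
  have hq : M 0 1 = 0 := by
    by_contra hq
    rcases lt_or_gt_of_ne hq with hq | hq <;> nlinarith
  rw [hq] at h01
  have : (b : ℤ) = b' := by simpa using h01
  exact_mod_cast this

theorem exists_isOrbitReps {s : ℕ} (hs : 0 < s) : ∃ R : Fin (psi s) → Mat, IsOrbitReps s R := by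
  let e := (primPairs s).equivFinOfCardEq (card_primPairs hs.ne')
  let m : (Σ _ : ℕ, ℕ) → Mat := fun x => !![((s / x.1 : ℕ) : ℤ), x.2; 0, x.1]
  have hmem {x : Σ _ : ℕ, ℕ} : x ∈ primPairs s ↔ x.1 ∣ s ∧ x.2 < x.1 ∧ (m x).IsPrimitive := by
    simp [primPairs, m, Mat.IsPrimitive, hs.ne', -Int.natCast_ediv, -Nat.cast_div]
  have hdet {x : Σ _ : ℕ, ℕ} (hx : x.1 ∣ s) : (m x).det = s := by
    have := Nat.div_mul_cancel hx
    rw [Matrix.det_fin_two_of]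
    simp only [mul_zero, sub_zero]
    exact_mod_cast this
  refine ⟨fun ν => m (e.symm ν).1, fun ν => ?_, fun T hTp hTd => ?_⟩
  · obtain ⟨h1, -, h2⟩ := hmem.mp (e.symm ν).2
    exact ⟨h2, hdet h1⟩
  obtain ⟨a, b, d, hbd, hT⟩ := exists_leftEquiv_triangular (T := T) (by rw [hTd]; exact_mod_cast hs)
  have had : a * d = s := by
    obtain ⟨M, hM⟩ := hT
    rw [hM, Mat.det_coe_mul, Matrix.det_fin_two_of] at hTd
    have : (a : ℤ) * d = s := by simpa using hTd
    exact_mod_cast this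
  have hd0 : 0 < d := by omega
  have hsd : s / d = a := by rw [← had, Nat.mul_div_cancel _ hd0]
  have hm : m ⟨d, b⟩ = !![(a : ℤ), b; 0, d] := by simp only [m, hsd]
  rw [← hm] at hT
  have hx : (⟨d, b⟩ : Σ _ : ℕ, ℕ) ∈ primPairs s := by
    refine hmem.mpr ⟨⟨a, by rw [← had, mul_comm]⟩, hbd, ?_⟩
    obtain ⟨M, hM⟩ := leftEquiv_equivalence.symm hT
    rw [hM]
    exact hTp.coe_mul M
  refine ⟨e ⟨_, hx⟩, by simpa using hT, fun ν hν => ?_⟩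
  rw [← Equiv.symm_apply_eq]
  obtain ⟨h1, h2, -⟩ := hmem.mp (e.symm ν).2
  have hd' : 0 < (e.symm ν).1.1 := by omega
  have key := eq_of_leftEquiv_triangular (Nat.div_pos (Nat.le_of_dvd hs h1) hd')
    (Nat.div_pos (Nat.le_of_dvd hs (hmem.mp hx).1) hd0)
    (by rw [Nat.div_mul_cancel h1, Nat.div_mul_cancel (hmem.mp hx).1]) h2 hbd
    (leftEquiv_equivalence.trans (leftEquiv_equivalence.symm hν) hT)
  ext1
  exact Sigma.ext key.1 (heq_of_eq key.2)

theorem analyticOrderAt_eval_comp {f : ℂ → ℂ} {z₀ : ℂ} (hf : AnalyticAt ℂ f z₀) {P : ℂ[X]}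
    (hP : P ≠ 0) : analyticOrderAt (fun z => P.eval (f z)) z₀ =
      P.rootMultiplicity (f z₀) • analyticOrderAt (fun z => f z - f z₀) z₀ := by
  obtain ⟨Q, hQ, hdvd⟩ := exists_eq_pow_rootMultiplicity_mul_and_not_dvd P hP (f z₀)
  have hQa : AnalyticAt ℂ (fun z => Q.eval (f z)) z₀ := by
    simpa [coe_aeval_eq_eval] using hf.aeval_polynomial Q
  have hfa : AnalyticAt ℂ (fun z => f z - f z₀) z₀ := hf.sub analyticAt_const
  have h0 : analyticOrderAt (fun z => Q.eval (f z)) z₀ = 0 :=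
    hQa.analyticOrderAt_eq_zero.mpr fun h => hdvd (dvd_iff_isRoot.mpr h)
  have : (fun z => P.eval (f z)) = (fun z => f z - f z₀) ^ P.rootMultiplicity (f z₀) *
      fun z => Q.eval (f z) := by
    ext z
    conv_lhs => rw [hQ]
    simp
  rw [this, analyticOrderAt_mul (hfa.pow _) hQa, h0, add_zero, analyticOrderAt_pow hfa]

theorem analyticOrderAt_finset_prod {ι : Type*} (t : Finset ι) {f : ι → ℂ → ℂ} {z₀ : ℂ}
    (hf : ∀ i ∈ t, AnalyticAt ℂ (f i) z₀) :
    analyticOrderAt (fun z => ∏ i ∈ t, f i z) z₀ = ∑ i ∈ t, analyticOrderAt (f i) z₀ := by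
  classical
  induction t using Finset.induction_on with
  | empty => simp [analyticAt_const.analyticOrderAt_eq_zero]
  | insert a t ha ih =>
    have ht : ∀ i ∈ t, AnalyticAt ℂ (f i) z₀ := fun i hi => hf i (Finset.mem_insert_of_mem hi)
    have : (fun z => ∏ i ∈ insert a t, f i z) = f a * fun z => ∏ i ∈ t, f i z := by
      ext z; simp [Finset.prod_insert ha]
    rw [this, analyticOrderAt_mul (hf a (Finset.mem_insert_self a t))
      (Finset.analyticAt_fun_prod t ht), ih ht, Finset.sum_insert ha]

theorem IsModularPoly.eval_diagPoly {s : ℕ} {J : ℤ[X][X]} (hJ : IsModularPoly s J)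
    {R : Fin (psi s) → Mat} (hR : IsOrbitReps s R) {z : ℂ} (hz : 0 < z.im) :
    ((diagPoly J).map (Int.castRingHom ℂ)).eval (jC z) = ∏ ν, (jC z - jC (moeb (R ν) z)) := by
  have h1 : evalAtJ z X = jC z := by simp [evalAtJ]
  have h2 : ((diagPoly J).map (Int.castRingHom ℂ)).eval (jC z) = evalAtJ z (J.eval X) := by
    rw [eval_map]; rfl
  rw [h2, ← eval₂_at_apply, h1, ← eval_map, hJ.2.2 R hR z hz, eval_prod]
  simp

theorem IsOrbitReps.exists_leftEquiv_moeb_eq_self {s n : ℕ} {R : Fin n → Mat}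
    (hR : IsOrbitReps s R) (hs : 0 < s) {ρ : ℂ} (hρ : 0 < ρ.im) {ν : Fin n}
    (h : jC (moeb (R ν) ρ) = jC ρ) :
    ∃ T : Mat, T.IsPrimitive ∧ T.det = (s : ℤ) ∧ moeb T ρ = ρ ∧ LeftEquiv T (R ν) := by
  obtain ⟨hp, hd⟩ := hR.1 ν
  obtain ⟨T, hT, hfix⟩ :=
    _root_.exists_leftEquiv_moeb_eq_self (by rw [hd]; exact_mod_cast hs) hρ h
  obtain ⟨M, rfl⟩ := id hT
  exact ⟨_, hp.coe_mul M, by rw [Mat.det_coe_mul, hd], hfix, hT⟩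

theorem analyticAt_jC_moeb {S : Mat} (hS : 0 < S.det) {z : ℂ} (hz : 0 < z.im) :
    AnalyticAt ℂ (fun w => jC (moeb S w)) z := by
  have hm : AnalyticAt ℂ (moeb S) z := by
    unfold moeb
    exact ((analyticAt_const.mul analyticAt_id).add analyticAt_const).div
      ((analyticAt_const.mul analyticAt_id).add analyticAt_const) (moeb_denom_ne_zero hS hz)
  exact (analyticAt_jC (moeb_im_pos hS hz)).comp hm

theorem IsOrbitReps.analyticOrderAt_jC_sub_jC_moeb {s n : ℕ} {R : Fin n → Mat}
    (hR : IsOrbitReps s R) (hs : 1 < s) {ρ : ℂ} (hρ : 0 < ρ.im) {ν : Fin n}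
    (h : jC (moeb (R ν) ρ) = jC ρ) :
    analyticOrderAt (fun z => jC z - jC (moeb (R ν) z)) ρ =
      analyticOrderAt (fun z => jC z - jC ρ) ρ := by
  obtain ⟨T, hTp, hTd, hfix, hT⟩ := hR.exists_leftEquiv_moeb_eq_self (by omega) hρ h
  rw [← analyticOrderAt_jC_moeb_sub hTp (by rw [hTd]; exact_mod_cast hs) hρ hfix,
    ← analyticOrderAt_neg]
  refine analyticOrderAt_congr ?_
  filter_upwards [(isOpen_lt continuous_const Complex.continuous_im).mem_nhds hρ] with z hz
  simp only [Pi.neg_apply, neg_sub]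
  rw [hT.jC_moeb_eq (by rw [(hR.1 ν).2]; exact_mod_cast (by omega : 0 < s)) hz]

theorem IsModularPoly.rootMultiplicity_diagPoly {s : ℕ} (hs : 1 < s) {J : ℤ[X][X]}
    (hJ : IsModularPoly s J) {R : Fin (psi s) → Mat} (hR : IsOrbitReps s R) {ρ : ℂ}
    (hρ : 0 < ρ.im) :
    ((diagPoly J).map (Int.castRingHom ℂ)).rootMultiplicity (jC ρ) =
      Nat.card {ν // jC (moeb (R ν) ρ) = jC ρ} := by
  classical
  set P := (diagPoly J).map (Int.castRingHom ℂ)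
  obtain ⟨e, he⟩ := ENat.ne_top_iff_exists.mp (analyticOrderAt_jC_ne_top hρ)
  have hpos (ν) : 0 < (R ν).det := by rw [(hR.1 ν).2]; exact_mod_cast (by omega : 0 < s)
  have hj := analyticAt_jC hρ
  have hsub : AnalyticAt ℂ (fun z => jC z - jC ρ) ρ := hj.sub analyticAt_const
  have he0 : e ≠ 0 := by
    rintro rfl
    exact hsub.analyticOrderAt_eq_zero.mp he.symm (sub_self _)
  have hsub' (ν) : AnalyticAt ℂ (fun z => jC z - jC (moeb (R ν) z)) ρ :=
    hj.sub (analyticAt_jC_moeb (hpos ν) hρ)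
  have hfac (ν) : analyticOrderAt (fun z => jC z - jC (moeb (R ν) z)) ρ =
      if jC (moeb (R ν) ρ) = jC ρ then (e : ℕ∞) else 0 := by
    split_ifs with h
    · rw [he, hR.analyticOrderAt_jC_sub_jC_moeb hs hρ h]
    · exact (hsub' ν).analyticOrderAt_eq_zero.mpr (sub_ne_zero.mpr (Ne.symm h))
  have hprod : analyticOrderAt (fun z => P.eval (jC z)) ρ =
      Nat.card {ν // jC (moeb (R ν) ρ) = jC ρ} • (e : ℕ∞) := by
    have : (fun z => P.eval (jC z)) =ᶠ[𝓝 ρ] fun z => ∏ ν, (jC z - jC (moeb (R ν) z)) := by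
      filter_upwards [(isOpen_lt continuous_const Complex.continuous_im).mem_nhds hρ] with z hz
      exact hJ.eval_diagPoly hR hz
    rw [analyticOrderAt_congr this, analyticOrderAt_finset_prod _ fun ν _ => hsub' ν]
    simp [hfac, Finset.sum_ite, Fintype.card_subtype]
  have hP : P ≠ 0 := by
    intro h
    simp only [h, eval_zero, analyticOrderAt_eq_top.mpr (Eventually.of_forall fun _ => rfl)]
      at hprod
    rw [nsmul_eq_mul] at hprod
    exact ENat.natCast_ne_top _ (by exact_mod_cast hprod.symm)
  rw [analyticOrderAt_eval_comp hj hP, ← he] at hprod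
  rw [nsmul_eq_mul, nsmul_eq_mul] at hprod
  exact Nat.eq_of_mul_eq_mul_right (Nat.pos_of_ne_zero he0) (by exact_mod_cast hprod)

theorem IsOrbitReps.card_quot_eq {s n : ℕ} (hs : 0 < s) {R : Fin n → Mat}
    (hR : IsOrbitReps s R) {ρ : ℂ} (hρ : 0 < ρ.im) :
    Nat.card (Quot (fun S T : {S : Mat // S.IsPrimitive ∧ S.det = (s : ℤ) ∧ moeb S ρ = ρ} =>
      LeftEquiv S.1 T.1)) = Nat.card {ν // jC (moeb (R ν) ρ) = jC ρ} := by
  have hpos (ν) : 0 < (R ν).det := by rw [(hR.1 ν).2]; exact_mod_cast hs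
  have hex (S : {S : Mat // S.IsPrimitive ∧ S.det = (s : ℤ) ∧ moeb S ρ = ρ}) :
      ∃ ν : {ν // jC (moeb (R ν) ρ) = jC ρ}, LeftEquiv S.1 (R ν) := by
    obtain ⟨ν, hν, -⟩ := hR.2 S.1 S.2.1 S.2.2.1
    refine ⟨⟨ν, ?_⟩, hν⟩
    rw [← hν.jC_moeb_eq (hpos ν) hρ, S.2.2.2]
  choose f hf using hex
  have huniq {S T : Mat} (hS : S.IsPrimitive) (hSd : S.det = s) (h : LeftEquiv S T) {μ ν}
      (hμ : LeftEquiv S (R μ)) (hν : LeftEquiv T (R ν)) : μ = ν :=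
    (hR.2 S hS hSd).unique hμ (leftEquiv_equivalence.trans h hν)
  refine Nat.card_congr (Equiv.ofBijective
    (Quot.lift f fun S T h => Subtype.ext (huniq S.2.1 S.2.2.1 h (hf S) (hf T))) ⟨?_, ?_⟩)
  · rintro ⟨S⟩ ⟨T⟩ (h : f S = f T)
    refine Quot.sound (leftEquiv_equivalence.trans (hf S) ?_)
    rw [h]
    exact leftEquiv_equivalence.symm (hf T)
  · rintro ⟨ν, hν⟩
    obtain ⟨T, hTp, hTd, hfix, hT⟩ := hR.exists_leftEquiv_moeb_eq_self hs hρ hν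
    exact ⟨Quot.mk _ ⟨T, hTp, hTd, hfix⟩,
      Subtype.ext (huniq hTp hTd (leftEquiv_equivalence.refl T) (hf ⟨T, hTp, hTd, hfix⟩) hT)⟩

end

/-- ξ is a root of J_s(X,X) iff ξ = j(ρ) for a fixed point ρ ∈ ℍ of a primitive
integer matrix of determinant s; every such ρ is imaginary quadratic; and the multiplicity
of j(ρ) as a root of J_s(X,X) equals the number of SL₂(ℤ)-inequivalent primitive matrices S
of determinant s with S·ρ = ρ. -/
theorem stmt7 (s : ℕ) (hs : 1 < s) (J : Polynomial (Polynomial ℤ)) (hJ : IsModularPoly s J) :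
    (∀ ξ : ℂ, ((diagPoly J).map (Int.castRingHom ℂ)).IsRoot ξ ↔
      ∃ ρ : ℂ, 0 < ρ.im ∧
        (∃ S : Mat, S.IsPrimitive ∧ S.det = (s : ℤ) ∧ moeb S ρ = ρ) ∧ ξ = jC ρ) ∧
    (∀ ρ : ℂ, 0 < ρ.im → (∃ S : Mat, S.IsPrimitive ∧ S.det = (s : ℤ) ∧ moeb S ρ = ρ) →
      Module.finrank ℚ ℚ⟮ρ⟯ = 2) ∧
    (∀ ρ : ℂ, 0 < ρ.im →
      ((diagPoly J).map (Int.castRingHom ℂ)).rootMultiplicity (jC ρ) =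
        Nat.card (Quot (fun S T : {S : Mat // S.IsPrimitive ∧ S.det = (s : ℤ) ∧ moeb S ρ = ρ} =>
          LeftEquiv S.1 T.1))) := by
  have hs0 : 0 < s := by omega
  obtain ⟨R, hR⟩ := exists_isOrbitReps hs0
  refine ⟨fun ξ => ⟨fun h => ?_, ?_⟩, ?_, fun ρ hρ => ?_⟩
  · obtain ⟨z, rfl⟩ := exists_jC_eq ξ
    rw [IsRoot.def, hJ.eval_diagPoly hR z.im_pos, Finset.prod_eq_zero_iff] at h
    obtain ⟨ν, -, hν⟩ := h
    obtain ⟨T, hp, hd, hfix, -⟩ :=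
      hR.exists_leftEquiv_moeb_eq_self hs0 z.im_pos (sub_eq_zero.mp hν).symm
    exact ⟨z, z.im_pos, ⟨T, hp, hd, hfix⟩, rfl⟩
  · rintro ⟨ρ, hρ, ⟨S, hp, hd, hfix⟩, rfl⟩
    obtain ⟨ν, hν, -⟩ := hR.2 S hp hd
    rw [IsRoot.def, hJ.eval_diagPoly hR hρ]
    refine Finset.prod_eq_zero (Finset.mem_univ ν) ?_
    rw [← hν.jC_moeb_eq (by rw [(hR.1 ν).2]; exact_mod_cast hs0) hρ, hfix, sub_self]
  · rintro ρ hρ ⟨S, hp, hd, hfix⟩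
    exact finrank_adjoin_of_moeb_eq_self hp (by rw [hd]; exact_mod_cast hs) hρ hfix
  · rw [hJ.rootMultiplicity_diagPoly hs hR hρ, hR.card_quot_eq hs0 hρ]

end
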